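/- There exists a constant C > 0 depending only on P and Q such that for every admissible prime p and all 1-bounded functions f0, f1, f2 : F_p^2 → ℂ where f1 is an eigenfunction with respect to the first coordinate and f2 is an eigenfunction with respect to the second coordinate, the counting operator 𝔼_{x1,x2,y} f0(x1,x2) f1(x1+P(y),x2) f2(x1,x2+Q(y)) equals 𝔼_{x1,x2} ( f0(x1,x2) · 𝔼_a f1(a,x2) · 𝔼_b f2(x1,b) ) up to an error of absolute value at most C · p^{-1/2}. -/

import Mathlib

open scoped BigOperators ComplexOrder
open Polynomial

noncomputable section

namespace RatCorners

/-- Reduction of a rational number modulo `p` (genuine when `p` does not divide the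
denominator). -/
def ratRed (p : ℕ) (q : ℚ) : ZMod p := (q.num : ZMod p) * (q.den : ZMod p)⁻¹

/-- Coefficientwise reduction of a polynomial with rational coefficients modulo `p`. -/
def polyRed (p : ℕ) (f : Polynomial ℚ) : Polynomial (ZMod p) :=
  f.sum fun n a => Polynomial.C (ratRed p a) * Polynomial.X ^ n

/-- `p` divides no denominator of any coefficient of `P` (with numerator and denominator
of `P` in lowest terms). -/
def Admissible (p : ℕ) (P : RatFunc ℚ) : Prop :=
  (∀ n, ¬ p ∣ (P.num.coeff n).den) ∧ ∀ n, ¬ p ∣ (P.denom.coeff n).den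

/-- `y` is a pole of the reduction of `P` modulo `p`. -/
def IsPole (p : ℕ) (P : RatFunc ℚ) (y : ZMod p) : Prop :=
  (polyRed p P.denom).eval y = 0

instance (p : ℕ) (P : RatFunc ℚ) : DecidablePred (IsPole p P) := fun y =>
  inferInstanceAs (Decidable ((polyRed p P.denom).eval y = 0))

/-- Evaluation of the reduction of `P` modulo `p` at `y` (junk value `0` at poles). -/
def evalRed (p : ℕ) (P : RatFunc ℚ) (y : ZMod p) : ZMod p :=
  (polyRed p P.num).eval y * ((polyRed p P.denom).eval y)⁻¹

/-- A function is `1`-bounded if all its values have norm at most `1`. -/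
def OneBounded {α : Type*} (f : α → ℂ) : Prop := ∀ x, ‖f x‖ ≤ 1

/-- The formal derivative of a rational function. -/
def ratDeriv (P : RatFunc ℚ) : RatFunc ℚ :=
  algebraMap (Polynomial ℚ) (RatFunc ℚ)
      (Polynomial.derivative P.num * P.denom - P.num * Polynomial.derivative P.denom) /
    algebraMap (Polynomial ℚ) (RatFunc ℚ) (P.denom ^ 2)

/-- Substitution of the variable `y i` into a rational function `P ∈ ℚ(t)`, producing an
element of the rational function field `ℚ(y 0, …, y (n-1))`. -/
def substAt {n : ℕ} (P : RatFunc ℚ) (i : Fin n) : FractionRing (MvPolynomial (Fin n) ℚ) :=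
  Polynomial.eval₂
      ((algebraMap (MvPolynomial (Fin n) ℚ) (FractionRing (MvPolynomial (Fin n) ℚ))).comp
        MvPolynomial.C)
      (algebraMap (MvPolynomial (Fin n) ℚ) (FractionRing (MvPolynomial (Fin n) ℚ))
        (MvPolynomial.X i)) P.num /
    Polynomial.eval₂
      ((algebraMap (MvPolynomial (Fin n) ℚ) (FractionRing (MvPolynomial (Fin n) ℚ))).comp
        MvPolynomial.C)
      (algebraMap (MvPolynomial (Fin n) ℚ) (FractionRing (MvPolynomial (Fin n) ℚ))
        (MvPolynomial.X i)) P.denom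

variable (p : ℕ) [NeZero p]

/-- The counting operator `𝔼_{x₁,x₂,y} f₀(x₁,x₂) f₁(x₁+P(y),x₂) f₂(x₁,x₂+Q(y))`,
where the average in `y` avoids the poles of `P` and `Q` but is still normalized by `1/p`. -/
def cornerAvg (P Q : RatFunc ℚ) (f0 f1 f2 : ZMod p × ZMod p → ℂ) : ℂ :=
  (p : ℂ)⁻¹ ^ 3 * ∑ x1 : ZMod p, ∑ x2 : ZMod p, ∑ y : ZMod p,
    if ¬ IsPole p P y ∧ ¬ IsPole p Q y then
      f0 (x1, x2) * f1 (x1 + evalRed p P y, x2) * f2 (x1, x2 + evalRed p Q y)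
    else 0

/-- The main term `𝔼_{x₁,x₂} f₀(x₁,x₂) · 𝔼_a f₁(a,x₂) · 𝔼_b f₂(x₁,b)`. -/
def mainTerm (f0 f1 f2 : ZMod p × ZMod p → ℂ) : ℂ :=
  (p : ℂ)⁻¹ ^ 2 * ∑ x1 : ZMod p, ∑ x2 : ZMod p,
    f0 (x1, x2) * ((p : ℂ)⁻¹ * ∑ a : ZMod p, f1 (a, x2)) *
      ((p : ℂ)⁻¹ * ∑ b : ZMod p, f2 (x1, b))

/-- The `L^r` norm with respect to the uniform probability measure on `(ZMod p)²`. -/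
def Lnorm (r : ℝ) (f : ZMod p × ZMod p → ℂ) : ℝ :=
  ((p : ℝ)⁻¹ ^ 2 * ∑ x : ZMod p × ZMod p, ‖f x‖ ^ r) ^ r⁻¹

/-- The Gowers norm `‖f‖_{U²(0×F_p)}` along the second coordinate axis. -/
def U2vert (f : ZMod p × ZMod p → ℂ) : ℝ :=
  ((p : ℝ)⁻¹ ^ 4 * (∑ x : ZMod p × ZMod p, ∑ h : ZMod p, ∑ k : ZMod p,
      f x * (starRingEnd ℂ) (f (x + (0, h))) * (starRingEnd ℂ) (f (x + (0, k))) *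
        f (x + (0, h + k))).re) ^ ((4:ℝ)⁻¹)

/-- The Gowers norm `‖f‖_{U²(F_p×0)}` along the first coordinate axis. -/
def U2horiz (f : ZMod p × ZMod p → ℂ) : ℝ :=
  ((p : ℝ)⁻¹ ^ 4 * (∑ x : ZMod p × ZMod p, ∑ h : ZMod p, ∑ k : ZMod p,
      f x * (starRingEnd ℂ) (f (x + (h, 0))) * (starRingEnd ℂ) (f (x + (k, 0))) *
        f (x + (h + k, 0))).re) ^ ((4:ℝ)⁻¹)

/-- The additive character `e_p(x) = e^{2πix/p}` on `ZMod p`. -/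
def ep (x : ZMod p) : ℂ := Complex.exp (2 * Real.pi * Complex.I * (x.val : ℂ) / (p : ℂ))

/-- `e(r) = e^{2πir}` for a real number `r`. -/
def eC (r : ℝ) : ℂ := Complex.exp (2 * Real.pi * Complex.I * (r : ℂ))

/-- The Fourier transform `f̂(ξ) = 𝔼_x f(x) e_p(−x·ξ)` on `(ZMod p)²`. -/
def dft (f : ZMod p × ZMod p → ℂ) (ξ : ZMod p × ZMod p) : ℂ :=
  (p : ℂ)⁻¹ ^ 2 * ∑ x : ZMod p × ZMod p, f x * ep p (-(x.1 * ξ.1 + x.2 * ξ.2))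

/-- `F₁(n₁,𝐡) = ∑_{n₂} Δ_{−𝐡} f̂₁(n₁,n₂)` where `Δ_h g(x) = g(x)·conj g(x+h)`. -/
def F1 (f : ZMod p × ZMod p → ℂ) (n1 : ZMod p) (h : ZMod p × ZMod p) : ℂ :=
  ∑ n2 : ZMod p, dft p f (n1, n2) * (starRingEnd ℂ) (dft p f ((n1, n2) + -h))

/-- `F₂(m₂,𝐡) = ∑_{m₁} Δ_{𝐡} f̂₂(m₁,m₂)` where `Δ_h g(x) = g(x)·conj g(x+h)`. -/
def F2 (f : ZMod p × ZMod p → ℂ) (m2 : ZMod p) (h : ZMod p × ZMod p) : ℂ :=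
  ∑ m1 : ZMod p, dft p f (m1, m2) * (starRingEnd ℂ) (dft p f ((m1, m2) + h))

/-- The `F_p`-points of the Roth variety for corners associated to `P, Q`:
tuples `(y₁,…,y₁₆)` (indexed here by `0,…,15`) avoiding all poles of `P` and `Q` and
satisfying the ten defining equations. -/
def IsRothPoint (P Q : RatFunc ℚ) (y : Fin 16 → ZMod p) : Prop :=
  (∀ i, ¬ IsPole p P (y i)) ∧ (∀ i, ¬ IsPole p Q (y i)) ∧
  evalRed p P (y 0) - evalRed p P (y 2) - evalRed p P (y 8) + evalRed p P (y 10) = 0 ∧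
  evalRed p P (y 1) - evalRed p P (y 3) - evalRed p P (y 9) + evalRed p P (y 11) = 0 ∧
  evalRed p P (y 4) - evalRed p P (y 6) - evalRed p P (y 12) + evalRed p P (y 14) = 0 ∧
  evalRed p P (y 5) - evalRed p P (y 7) - evalRed p P (y 13) + evalRed p P (y 15) = 0 ∧
  evalRed p Q (y 0) - evalRed p Q (y 1) - evalRed p Q (y 8) + evalRed p Q (y 9) = 0 ∧
  evalRed p Q (y 2) - evalRed p Q (y 6) - evalRed p Q (y 10) + evalRed p Q (y 14) = 0 ∧
  evalRed p Q (y 3) - evalRed p Q (y 7) - evalRed p Q (y 11) + evalRed p Q (y 15) = 0 ∧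
  evalRed p Q (y 4) - evalRed p Q (y 5) - evalRed p Q (y 12) + evalRed p Q (y 13) = 0 ∧
  evalRed p P (y 8) - evalRed p P (y 9) - evalRed p P (y 10) + evalRed p P (y 11) -
      evalRed p P (y 12) + evalRed p P (y 13) + evalRed p P (y 14) - evalRed p P (y 15) = 0 ∧
  evalRed p Q (y 8) - evalRed p Q (y 9) - evalRed p Q (y 10) + evalRed p Q (y 11) -
      evalRed p Q (y 12) + evalRed p Q (y 13) + evalRed p Q (y 14) - evalRed p Q (y 15) = 0

/-- `|Y(F_p)|`, the number of `F_p`-points of the Roth variety for corners. -/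
def rothCard (P Q : RatFunc ℚ) : ℕ :=
  Nat.card {y : Fin 16 → ZMod p // IsRothPoint p P Q y}

/-- `χ` is an eigenfunction with respect to the first coordinate:
`χ(x₁,x₂) = 1_E(x₂) e_p(φ(x₂)x₁) e(ψ(x₂))`. -/
def IsEigen1 (χ : ZMod p × ZMod p → ℂ) : Prop :=
  ∃ (E : Finset (ZMod p)) (φ : ZMod p → ZMod p) (ψ : ZMod p → ℝ),
    ∀ x1 x2 : ZMod p,
      χ (x1, x2) = (if x2 ∈ E then 1 else 0) * ep p (φ x2 * x1) * eC (ψ x2)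

/-- `χ` is an eigenfunction with respect to the second coordinate:
`χ(x₁,x₂) = 1_E(x₁) e_p(φ(x₁)x₂) e(ψ(x₁))`. -/
def IsEigen2 (χ : ZMod p × ZMod p → ℂ) : Prop :=
  ∃ (E : Finset (ZMod p)) (φ : ZMod p → ZMod p) (ψ : ZMod p → ℝ),
    ∀ x1 x2 : ZMod p,
      χ (x1, x2) = (if x1 ∈ E then 1 else 0) * ep p (φ x1 * x2) * eC (ψ x1)

/-- The two-term counting operator `𝔼_{x₁,x₂,y} f₀(x₁,x₂) f₁(x₁+P(y),x₂)`. -/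
def twoAvg1 (P : RatFunc ℚ) (f0 f1 : ZMod p × ZMod p → ℂ) : ℂ :=
  (p : ℂ)⁻¹ ^ 3 * ∑ x1 : ZMod p, ∑ x2 : ZMod p, ∑ y : ZMod p,
    if ¬ IsPole p P y then f0 (x1, x2) * f1 (x1 + evalRed p P y, x2) else 0

/-- The two-term counting operator `𝔼_{x₁,x₂,y} f₀(x₁,x₂) f₁(x₁,x₂+P(y))`. -/
def twoAvg2 (P : RatFunc ℚ) (f0 f1 : ZMod p × ZMod p → ℂ) : ℂ :=
  (p : ℂ)⁻¹ ^ 3 * ∑ x1 : ZMod p, ∑ x2 : ZMod p, ∑ y : ZMod p,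
    if ¬ IsPole p P y then f0 (x1, x2) * f1 (x1, x2 + evalRed p P y) else 0

/-- A combination of products `(X - α) ^ v t * w t` with pairwise distinct exponents and cofactors
not vanishing at `α` is nonzero as soon as one coefficient is. -/
theorem sum_C_mul_pow_mul_ne_zero {K ι : Type*} [Field K] [Fintype ι] (α : K) (a : ι → K)
    (v : ι → ℕ) (hv : Function.Injective v) (w : ι → K[X]) (hw : ∀ t, (w t).eval α ≠ 0)
    (ha : ∃ t, a t ≠ 0) : ∑ t, C (a t) * ((X - C α) ^ v t * w t) ≠ 0 := by
  classical
  intro h0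
  obtain ⟨t, ht, hmin⟩ := Finset.exists_min_image (Finset.univ.filter fun t => a t ≠ 0) v
    (by obtain ⟨t, ht⟩ := ha; exact ⟨t, by simpa using ht⟩)
  simp only [Finset.mem_filter, Finset.mem_univ, true_and] at ht hmin
  have hdvd : (X - C α) ^ (v t + 1) ∣ C (a t) * ((X - C α) ^ v t * w t) := by
    rw [← Finset.add_sum_erase _ _ (Finset.mem_univ t)] at h0
    rw [eq_neg_of_add_eq_zero_left h0, dvd_neg]
    refine Finset.dvd_sum fun s hs => ?_
    by_cases hs0 : a s = 0
    · simp [hs0]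
    · have hlt : v t < v s := lt_of_le_of_ne (hmin s hs0)
        fun h => (Finset.ne_of_mem_erase hs) (hv h.symm)
      exact Dvd.dvd.mul_left (Dvd.dvd.mul_right (pow_dvd_pow _ hlt) _) _
  have h1 : (X - C α) ∣ C (a t) * w t := by
    have h2 : (X - C α) ^ v t * (X - C α) ∣ (X - C α) ^ v t * (C (a t) * w t) := by
      rw [← pow_succ]; convert hdvd using 1; ring
    exact (mul_dvd_mul_iff_left (pow_ne_zero _ (X_sub_C_ne_zero α))).1 h2
  rw [dvd_iff_isRoot, IsRoot, eval_mul, eval_C] at h1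
  exact (mul_ne_zero ht (hw t)) h1

/-- Fewer dimensions than polynomials of small degree forces a linear relation. -/
theorem exists_sum_C_mul_eq_zero {K ι : Type*} [Field K] [Fintype ι] (E : ι → K[X]) (N : ℕ)
    (hE : ∀ t, (E t).degree < N) (hN : N < Fintype.card ι) :
    ∃ b : ι → K, ∑ t, C (b t) * E t = 0 ∧ ∃ t, b t ≠ 0 := by
  let v : ι → degreeLT K N := fun t => ⟨E t, mem_degreeLT.2 (hE t)⟩
  have hnl : ¬ LinearIndependent K v := by
    intro h
    have := h.fintype_card_le_finrank
    rw [(degreeLTEquiv K N).finrank_eq, Module.finrank_fin_fun] at this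
    omega
  obtain ⟨b, hb, hb'⟩ := Fintype.not_linearIndependent_iff.1 hnl
  refine ⟨b, ?_, hb'⟩
  have := congrArg (Subtype.val) hb
  simpa [v, smul_eq_C_mul] using this

theorem stepanov_exponent_injective {p e l n : ℕ} (hp : p.Prime) (he : 0 < e) (hep : e < p)
    (hl : 0 < l) :
    Function.Injective fun t : Fin l × Fin n × Fin p =>
      (t.1 : ℕ) + l * (p * (t.2.1 : ℕ) + (p - 1 - (t.2.2 : ℕ)) * e) := by
  rintro ⟨⟨k, hk⟩, ⟨i, hi⟩, ⟨j, hj⟩⟩ ⟨⟨k', hk'⟩, ⟨i', hi'⟩, ⟨j', hj'⟩⟩ h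
  simp only at h
  have h1 : k = k' := by
    have := congrArg (· % l) h
    simpa [Nat.add_mul_mod_self_left, Nat.mod_eq_of_lt hk, Nat.mod_eq_of_lt hk'] using this
  subst h1
  have h2 := Nat.eq_of_mul_eq_mul_left hl (Nat.add_left_cancel h)
  have h3 : (p - 1 - j) * e ≡ (p - 1 - j') * e [MOD p] := by
    have := congrArg (· % p) h2
    simpa [Nat.mul_add_mod, Nat.ModEq] using this
  have hcop : Nat.gcd p e = 1 :=
    (Nat.Prime.coprime_iff_not_dvd hp).2 (Nat.not_dvd_of_pos_of_lt he hep)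
  have h4 := Nat.ModEq.cancel_right_of_coprime hcop h3
  have h5 : p - 1 - j = p - 1 - j' :=
    Nat.ModEq.eq_of_lt_of_lt h4 (by omega) (by omega)
  have h6 : j = j' := by omega
  subst h6
  have h7 : i = i' := Nat.eq_of_mul_eq_mul_left hp.pos (Nat.add_right_cancel h2)
  subst h7
  rfl

theorem stepanov_dimension_count {p l u d : ℕ} (hu : u = p * l) (hl : 0 < l) (hp : 2 ≤ p) :
    u * (l - 1) + (l + d + 1 - 1) + (p - 1) * (d * l) + 1 < l * ((l + d + 1) * p) := by
  obtain ⟨l, rfl⟩ : ∃ l', l = l' + 1 := ⟨l - 1, by omega⟩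
  obtain ⟨p, rfl⟩ : ∃ p', p = p' + 1 := ⟨p - 1, by omega⟩
  subst hu
  simp only [Nat.add_sub_cancel]
  have : (l + 1) * ((l + 1 + d + 1) * (p + 1)) = (p + 1) * (l + 1) * l + (l + 1 + d) +
    p * (d * (l + 1)) + 1 + (2 * p * l + l + d * l + 2 * p) := by ring
  rw [this]
  omega

theorem stepanov_bound {p : ℕ} [Fact p.Prime] {K : Type*} [Field K] [Fintype K] [CharP K p]
    (M : ℕ) (hcard : Fintype.card K = p ^ (2 * (M + 1))) (g h : K[X]) (hh0 : h ≠ 0)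
    (hcop : IsCoprime g h) (hdeg : g.natDegree ≤ h.natDegree) (hdp : h.natDegree < p) (α : K) (hα : h.IsRoot α) (c : K)
    (Z : Finset K) (hZ : ∀ x ∈ Z, h.eval x ≠ 0 ∧
      ∑ i ∈ Finset.range (2 * (M + 1)), (g.eval x / h.eval x) ^ p ^ i = c) :
    Z.card ≤ p ^ (2 * M + 1) + (2 * h.natDegree + 1) * p ^ (M + 1) := by
  classical
  have hp : p.Prime := Fact.out
  set d := h.natDegree with hd
  set l := p ^ M with hl
  set u := p ^ (M + 1) with hu
  have hup : u = p * l := by rw [hu, hl, pow_succ, mul_comm]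
  have hl0 : 0 < l := pow_pos hp.pos _
  have hu0 : 0 < u := pow_pos hp.pos _
  have hq : u * u = Fintype.card K := by rw [hcard, hu, ← pow_add]; congr 1; ring
  have hcharX : ExpChar K p := ExpChar.prime hp
  have hcharP : ExpChar K[X] p := ExpChar.prime hp
  have hpow : ∀ x : K, (x ^ u) ^ u = x := fun x => by
    rw [← pow_mul, hq, FiniteField.pow_card]
  set e := h.rootMultiplicity α with he
  have he0 : 0 < e := (rootMultiplicity_pos hh0).2 hα
  have hed : e ≤ d := by
    classical
    rw [he, hd, ← count_roots]
    exact (Multiset.count_le_card _ _).trans (card_roots' h)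
  obtain ⟨h₁, hh₁, hh₁α⟩ := exists_eq_pow_rootMultiplicity_mul_and_not_dvd h hh0 α
  rw [← he] at hh₁
  set G : K[X] := ∑ i ∈ Finset.range (M + 1), g ^ p ^ i * h ^ (l - p ^ i) with hG
  set H : K[X] := h ^ l with hH
  have hpl : ∀ i ∈ Finset.range (M + 1), p ^ i ≤ l := fun i hi =>
    Nat.pow_le_pow_right hp.pos (by simpa [Nat.lt_succ_iff] using hi)
  have hGdeg : G.natDegree ≤ d * l := by
    refine natDegree_sum_le_of_forall_le _ _ fun i hi => ?_
    refine natDegree_mul_le.trans ?_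
    have h1 := natDegree_pow_le (p := g) (n := p ^ i)
    have h2 := natDegree_pow_le (p := h) (n := l - p ^ i)
    have h3 := hpl i hi
    calc _ ≤ p ^ i * d + (l - p ^ i) * d := by
          refine add_le_add (h1.trans ?_) h2
          exact Nat.mul_le_mul_left _ hdeg
      _ = d * l := by rw [← add_mul, Nat.add_sub_cancel' h3, mul_comm]
  have hHdeg : H.natDegree ≤ d * l := by
    rw [hH]; exact natDegree_pow_le.trans (by rw [mul_comm])
  have hGα : G.eval α ≠ 0 := by
    have hgα : g.eval α ≠ 0 := by
      intro h0
      obtain ⟨a, b, hab⟩ := hcop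
      have := congrArg (eval α) hab
      simp [h0, hα.eq_zero] at this
    rw [hG, eval_finsetSum, Finset.sum_range_succ, Finset.sum_eq_zero]
    · simp [hl, hgα]
    · intro i hi
      have : l - p ^ i ≠ 0 := by
        have := Nat.pow_lt_pow_right hp.one_lt (Finset.mem_range.1 hi)
        omega
      simp [hα.eq_zero, this]
  let n := l + d + 1
  let E : Fin l × Fin n × Fin p → K[X] := fun t =>
    (X - C α) ^ (u * (t.1 : ℕ) + (t.2.1 : ℕ)) * ((C c * H - G) ^ (t.2.2 : ℕ) *
      H ^ (p - 1 - (t.2.2 : ℕ)))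
  have hEdeg : ∀ t, (E t).natDegree ≤ u * (l - 1) + (n - 1) + (p - 1) * (d * l) := by
    rintro ⟨⟨k, hk⟩, ⟨i, hi⟩, ⟨j, hj⟩⟩
    refine natDegree_mul_le.trans (add_le_add ?_ ?_)
    · rw [natDegree_pow, natDegree_X_sub_C, mul_one]
      exact add_le_add (Nat.mul_le_mul_left _ (by omega)) (by simp only; omega)
    · refine natDegree_mul_le.trans ?_
      have h1 : (C c * H - G).natDegree ≤ d * l :=
        (natDegree_sub_le _ _).trans (max_le ((natDegree_C_mul_le _ _).trans hHdeg) hGdeg)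
      calc _ ≤ j * (d * l) + (p - 1 - j) * (d * l) :=
            add_le_add (natDegree_pow_le.trans (Nat.mul_le_mul_left _ h1))
              (natDegree_pow_le.trans (Nat.mul_le_mul_left _ hHdeg))
        _ = _ := by rw [← add_mul]; congr 1; omega
  obtain ⟨b, hb, hb0⟩ := exists_sum_C_mul_eq_zero E
    (u * (l - 1) + (n - 1) + (p - 1) * (d * l) + 1)
    (fun t => lt_of_le_of_lt degree_le_natDegree (by exact_mod_cast Nat.lt_succ_of_le (hEdeg t))) (by
      simp only [Fintype.card_prod, Fintype.card_fin]
      exact stepanov_dimension_count hup hl0 hp.two_le)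
  let R : K[X] := ∑ t : Fin l × Fin n × Fin p, C (b t ^ u) *
    ((X - C α) ^ ((t.1 : ℕ) + u * (t.2.1 : ℕ)) * (G ^ (t.2.2 : ℕ) * H ^ (p - 1 - (t.2.2 : ℕ))))
  have hR0 : R ≠ 0 := by
    have := sum_C_mul_pow_mul_ne_zero α (fun t => b t ^ u) _
      (stepanov_exponent_injective (n := n) hp he0 (by omega) hl0)
      (fun t => G ^ (t.2.2 : ℕ) * (h₁ ^ l) ^ (p - 1 - (t.2.2 : ℕ)))
      (fun t => by
        rw [dvd_iff_isRoot, IsRoot] at hh₁α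
        simp [hGα, hh₁α])
      (by obtain ⟨t, ht⟩ := hb0; exact ⟨t, pow_ne_zero _ ht⟩)
    convert this using 1
    refine Finset.sum_congr rfl fun t _ => ?_
    have hHe : H = (X - C α) ^ (l * e) * h₁ ^ l := by
      rw [hH, hh₁, mul_pow, ← pow_mul, mul_comm e l]
    rw [hHe, hup]
    ring
  have hRdeg : R.natDegree ≤ (l - 1) + u * (n - 1) + (p - 1) * (d * l) := by
    refine natDegree_sum_le_of_forall_le _ _ ?_
    rintro ⟨⟨k, hk⟩, ⟨i, hi⟩, ⟨j, hj⟩⟩ -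
    refine (natDegree_C_mul_le _ _).trans (natDegree_mul_le.trans (add_le_add ?_ ?_))
    · rw [natDegree_pow, natDegree_X_sub_C, mul_one]
      exact add_le_add (by simp only; omega) (Nat.mul_le_mul_left _ (by simp only; omega))
    · refine natDegree_mul_le.trans ?_
      calc _ ≤ j * (d * l) + (p - 1 - j) * (d * l) :=
            add_le_add (natDegree_pow_le.trans (Nat.mul_le_mul_left _ hGdeg))
              (natDegree_pow_le.trans (Nat.mul_le_mul_left _ hHdeg))
        _ = _ := by rw [← add_mul]; congr 1; omega
  have hRroot : ∀ x ∈ Z, R.eval x = 0 := by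
    intro x hx
    obtain ⟨hhx, hTr⟩ := hZ x hx
    set A := ∑ i ∈ Finset.range (M + 1), (g.eval x / h.eval x) ^ p ^ i with hA
    have hGx : G.eval x = A * H.eval x := by
      rw [hG, hH, hA, eval_finsetSum, Finset.sum_mul]
      refine Finset.sum_congr rfl fun i hi => ?_
      obtain ⟨r, hr⟩ : ∃ r, l = p ^ i + r := ⟨l - p ^ i, (Nat.add_sub_cancel' (hpl i hi)).symm⟩
      rw [eval_mul, eval_pow, eval_pow, eval_pow, div_pow, hr, Nat.add_sub_cancel_left, pow_add]
      field_simp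
    have hAu : A ^ u = c - A := by
      rw [eq_sub_iff_add_eq', ← hTr, two_mul, Finset.sum_range_add, hA, hu, sum_pow_char_pow]
      congr 1
      refine Finset.sum_congr rfl fun i _ => ?_
      rw [← pow_mul, ← pow_add, add_comm]
    have hHx : H.eval x ≠ 0 := by rw [hH, eval_pow]; exact pow_ne_zero _ hhx
    have hEx : ∑ t, b t * (E t).eval x = 0 := by
      have := congrArg (eval x) hb
      simpa [eval_finsetSum] using this
    have hkey : (R.eval x) ^ u * (H.eval x) ^ (p - 1) =
        (H.eval x) ^ (u * (p - 1)) * ∑ t, b t * (E t).eval x := by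
      rw [eval_finsetSum, hu, sum_pow_char_pow, ← hu, Finset.sum_mul, Finset.mul_sum]
      refine Finset.sum_congr rfl fun t _ => ?_
      obtain ⟨⟨k, hk⟩, ⟨i, hi⟩, ⟨j, hj⟩⟩ := t
      simp only [E, eval_mul, eval_C, eval_pow, eval_sub, eval_X, hGx, mul_pow, hpow]
      have e1 : ((x - α) ^ (k + u * i)) ^ u = (x - α) ^ (u * k + i) := by
        rw [pow_add, pow_add, mul_pow]
        congr 1
        · rw [← pow_mul, mul_comm]
        · rw [pow_mul, ← pow_mul, mul_comm, pow_mul, hpow]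
      have e2 : (A ^ j) ^ u = (c - A) ^ j := by rw [← pow_mul, mul_comm, pow_mul, hAu]
      have e3 : c * eval x H - A * eval x H = (c - A) * eval x H := by ring
      rw [e1, e2, e3, mul_pow]
      obtain ⟨r, hr⟩ : ∃ r, p - 1 = j + r := ⟨p - 1 - j, by omega⟩
      rw [hr, Nat.add_sub_cancel_left]
      ring
    rw [hEx, mul_zero] at hkey
    have := (mul_eq_zero.1 hkey).resolve_right (pow_ne_zero _ hHx)
    exact pow_eq_zero_iff hu0.ne' |>.1 this
  have hle : Z.card ≤ R.natDegree := by
    have h1 : Z ⊆ R.roots.toFinset := fun x hx => by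
      simp [hR0, hRroot x hx]
    exact (Finset.card_le_card h1).trans ((Multiset.toFinset_card_le _).trans (card_roots' R))
  refine hle.trans (hRdeg.trans ?_)
  have e1 : p ^ (2 * M + 1) = u * l := by rw [hu, hl, ← pow_add]; congr 1; ring
  have e2 : (p - 1) * (d * l) ≤ d * u := by
    rw [hup]; calc _ ≤ p * (d * l) := Nat.mul_le_mul_right _ (Nat.sub_le _ _)
      _ = _ := by ring
  have e3 : l ≤ u := by rw [hup]; exact Nat.le_mul_of_pos_left _ hp.pos
  have e4 : u * (n - 1) = u * l + u * d := by simp only [n, Nat.add_sub_cancel, mul_add]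
  rw [e1, e4]
  have : (2 * d + 1) * u = d * u + u * d + u := by ring
  omega

section RootTrace

variable {F : Type*} [Field F]

/-- The numerator `U` modulo `h` of the logarithmic-derivative fraction `g * m' / m`, that is, the
unique `U` of degree less than `h.degree` with `h ∣ U * m - g * m'`; junk value `0` if `m` is not
coprime to `h`. -/
def resNum (g h m : F[X]) : F[X] :=
  open Classical in
  if hc : IsCoprime m h then (g * derivative m * hc.choose) %ₘ h else 0

/-- The sum of `g / h` over the roots of `m`, expressed rationally in `m`. -/
def rootTrace (g h m : F[X]) : F := -(resNum g h m).coeff (h.natDegree - 1)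

variable {g h m m₁ m₂ : F[X]}

theorem degree_resNum_lt (hh : h.Monic) : (resNum g h m).degree < h.degree := by
  unfold resNum
  split_ifs
  · exact degree_modByMonic_lt _ hh
  · rw [degree_zero]
    exact bot_lt_iff_ne_bot.2 (degree_eq_bot.not.2 hh.ne_zero)

theorem dvd_resNum_mul_sub (hc : IsCoprime m h) :
    h ∣ resNum g h m * m - g * derivative m := by
  rw [resNum, dif_pos hc]
  obtain ⟨b, hb⟩ := hc.choose_spec
  have := modByMonic_add_div (g * derivative m * hc.choose) h
  refine ⟨-((g * derivative m * hc.choose) /ₘ h * m) - g * derivative m * b, ?_⟩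
  linear_combination m * this + g * derivative m * hb

theorem resNum_eq (hh : h.Monic) (hc : IsCoprime m h) {U : F[X]} (hU : U.degree < h.degree)
    (hd : h ∣ U * m - g * derivative m) : resNum g h m = U := by
  have h1 : h ∣ (resNum g h m - U) * m := by
    have := dvd_sub (dvd_resNum_mul_sub (g := g) hc) hd
    convert this using 1; ring
  have h2 := hc.symm.dvd_of_dvd_mul_right h1
  exact sub_eq_zero.1 (eq_zero_of_dvd_of_degree_lt h2
    ((degree_sub_le _ _).trans_lt (max_lt (degree_resNum_lt hh) hU)))

theorem rootTrace_one (hh : h.Monic) : rootTrace g h 1 = 0 := by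
  rw [rootTrace, resNum_eq hh isCoprime_one_left (U := 0)]
  · simp
  · rw [degree_zero]
    exact bot_lt_iff_ne_bot.2 (degree_eq_bot.not.2 hh.ne_zero)
  · simp

theorem rootTrace_mul (hh : h.Monic) (h₁ : IsCoprime m₁ h) (h₂ : IsCoprime m₂ h) :
    rootTrace g h (m₁ * m₂) = rootTrace g h m₁ + rootTrace g h m₂ := by
  rw [rootTrace, resNum_eq hh (h₁.mul_left h₂) (U := resNum g h m₁ + resNum g h m₂)]
  · rw [coeff_add, rootTrace, rootTrace]; ring
  · exact (degree_add_le _ _).trans_lt (max_lt (degree_resNum_lt hh) (degree_resNum_lt hh))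
  · have := dvd_add ((dvd_resNum_mul_sub (g := g) h₁).mul_right m₂)
      ((dvd_resNum_mul_sub (g := g) h₂).mul_right m₁)
    convert this using 1
    rw [derivative_mul]; ring

theorem rootTrace_prod {ι : Type*} (hh : h.Monic) (s : Finset ι) (m : ι → F[X])
    (hc : ∀ i ∈ s, IsCoprime (m i) h) :
    rootTrace g h (∏ i ∈ s, m i) = ∑ i ∈ s, rootTrace g h (m i) := by
  classical
  induction s using Finset.induction_on with
  | empty => simpa using rootTrace_one hh
  | insert a s ha ih =>
    rw [Finset.prod_insert ha, Finset.sum_insert ha, rootTrace_mul hh (hc a (by simp))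
      (IsCoprime.prod_left fun i hi => hc i (by simp [hi])), ih fun i hi => hc i (by simp [hi])]

theorem rootTrace_add_sq_mul (hh : h.Monic) (hc : IsCoprime m h) (k : F[X]) :
    rootTrace g h (m + h ^ 2 * k) = rootTrace g h m := by
  have hc' : IsCoprime (m + h ^ 2 * k) h := by
    rw [pow_two, mul_assoc]; exact hc.add_mul_left_left _
  rw [rootTrace, rootTrace, resNum_eq hh hc' (degree_resNum_lt (g := g) (m := m) hh)]
  obtain ⟨w, hw⟩ := dvd_resNum_mul_sub (g := g) hc
  refine ⟨w + resNum g h m * h * k - g * (2 * derivative h * k + h * derivative k), ?_⟩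
  simp only [derivative_mul, derivative_add, derivative_pow, map_natCast]
  push_cast
  simp only [pow_one]
  linear_combination hw

theorem rootTrace_map {K : Type*} [Field K] (f : F →+* K) (hh : h.Monic) (hc : IsCoprime m h) :
    rootTrace (g.map f) (h.map f) (m.map f) = f (rootTrace g h m) := by
  rw [rootTrace, resNum_eq (hh.map f) (m := m.map f) (hc.map (mapRingHom f)) (U := (resNum g h m).map f)]
  · simp [rootTrace]
  · rw [degree_map, degree_map]; exact degree_resNum_lt hh
  · have := Polynomial.map_dvd f (dvd_resNum_mul_sub (g := g) hc)
    simpa [derivative_map] using this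

theorem isCoprime_X_sub_C_iff {a : F} : IsCoprime (X - C a) h ↔ h.eval a ≠ 0 := by
  rw [(irreducible_X_sub_C a).coprime_iff_not_dvd, dvd_iff_isRoot]; rfl

theorem rootTrace_X_sub_C (hh : h.Monic) (hg : g.degree < h.degree) {a : F} (ha : h.eval a ≠ 0) :
    rootTrace g h (X - C a) = g.eval a / h.eval a := by
  rcases eq_or_ne g 0 with rfl | hg0
  · rw [rootTrace, resNum_eq hh (isCoprime_X_sub_C_iff.2 ha) (U := 0) hg (by simp)]
    simp
  have hd0 : 0 < h.natDegree :=
    Nat.pos_of_ne_zero fun h0 => absurd (natDegree_lt_natDegree hg0 hg) (by omega)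
  have eh := modByMonic_add_div h (X - C a)
  have eg := modByMonic_add_div g (X - C a)
  rw [modByMonic_X_sub_C_eq_C_eval] at eg eh
  set s := g /ₘ (X - C a)
  set w := h /ₘ (X - C a)
  rw [rootTrace, resNum_eq hh (isCoprime_X_sub_C_iff.2 ha)
    (U := s - C (g.eval a / h.eval a) * w)]
  · have hs : s.coeff (h.natDegree - 1) = 0 := by
      rcases Nat.eq_zero_or_pos g.natDegree with h0 | h0
      · have : s = 0 := (divByMonic_eq_zero_iff (monic_X_sub_C a)).2 (by
          rw [eq_C_of_natDegree_eq_zero h0, degree_X_sub_C]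
          exact degree_C_le.trans_lt (by norm_num))
        rw [this, coeff_zero]
      · apply coeff_eq_zero_of_natDegree_lt
        rw [natDegree_divByMonic g (monic_X_sub_C a), natDegree_X_sub_C]
        have := natDegree_lt_natDegree hg0 hg
        omega
    have hw : w.coeff (h.natDegree - 1) = 1 := by
      have h1 : w.natDegree = h.natDegree - 1 := by
        rw [natDegree_divByMonic h (monic_X_sub_C a), natDegree_X_sub_C]
      have h2 := leadingCoeff_divByMonic_X_sub_C h (natDegree_pos_iff_degree_pos.1 hd0).ne' a
      rw [leadingCoeff, hh.leadingCoeff] at h2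
      rwa [← h1]
    rw [coeff_sub, coeff_C_mul, hs, hw]; ring
  · refine (degree_sub_le _ _).trans_lt (max_lt ?_ ?_)
    · exact (degree_divByMonic_le _ _).trans_lt hg
    · have hw : w.degree < h.degree :=
        degree_divByMonic_lt h (X - C a) hh.ne_zero (by rw [degree_X_sub_C]; norm_num)
      rw [← smul_eq_C_mul]
      exact (degree_smul_le _ w).trans_lt hw
  · refine ⟨- C (g.eval a / h.eval a), ?_⟩
    have : C (g.eval a / h.eval a) * C (h.eval a) = C (g.eval a) := by
      rw [← C_mul, div_mul_cancel₀ _ ha]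
    simp only [derivative_sub, derivative_X, derivative_C]
    linear_combination eg - C (g.eval a / h.eval a) * eh + this

end RootTrace

section FieldPolynomial

variable (F : Type*) {K : Type*} [Field F] [Field K] [Algebra F K]

/-- The field polynomial of `x`: the power of its minimal polynomial whose degree is `[K : F]`. -/
def fieldPoly (x : K) : F[X] := minpoly F x ^ (Module.finrank F K / (minpoly F x).natDegree)

variable [FiniteDimensional F K]

theorem monic_fieldPoly (x : K) : (fieldPoly F x).Monic :=
  (minpoly.monic (.of_finite F x)).pow _

theorem natDegree_fieldPoly (x : K) : (fieldPoly F x).natDegree = Module.finrank F K := by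
  rw [fieldPoly, natDegree_pow]
  exact Nat.div_mul_cancel (minpoly.degree_dvd (.of_finite F x))

theorem isCoprime_fieldPoly_iff (x : K) (h : F[X]) :
    IsCoprime (fieldPoly F x) h ↔ aeval x h ≠ 0 := by
  have hpos : 0 < Module.finrank F K / (minpoly F x).natDegree :=
    Nat.div_pos (minpoly.natDegree_le x) (minpoly.natDegree_pos (.of_finite F x))
  rw [fieldPoly, IsCoprime.pow_left_iff hpos,
    (minpoly.irreducible (.of_finite F x)).coprime_iff_not_dvd, minpoly.dvd_iff]

theorem map_fieldPoly [IsGalois F K] (x : K) :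
    (fieldPoly F x).map (algebraMap F K) = ∏ σ : Gal(K/F), (X - C (σ x)) := by
  classical
  obtain ⟨q, hq, hqdeg, hqm⟩ := Polynomial.lifts_and_degree_eq_and_monic
    (Algebra.IsInvariant.charpoly_mem_lifts F K Gal(K/F) x)
    (MulSemiringAction.monic_charpoly Gal(K/F) x)
  rw [MulSemiringAction.charpoly_eq] at hq hqdeg
  change q.map _ = ∏ σ : Gal(K/F), (X - C (σ x)) at hq
  rw [← hq]
  congr 1
  have hq0 : q ≠ 0 := hqm.ne_zero
  have hfac : ∀ π ∈ UniqueFactorizationMonoid.normalizedFactors q, π = minpoly F x := by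
    intro π hπ
    have hirr := UniqueFactorizationMonoid.irreducible_of_normalized_factor π hπ
    have hdvd := UniqueFactorizationMonoid.dvd_of_mem_normalizedFactors hπ
    have hmon : π.Monic := by
      have := UniqueFactorizationMonoid.normalize_normalized_factor π hπ
      rw [← this]; exact Polynomial.monic_normalize hirr.ne_zero
    have hspl : (π.map (algebraMap F K)).Splits := by
      refine Splits.of_dvd ?_ (Polynomial.map_ne_zero hq0)
        (Polynomial.map_dvd (algebraMap F K) hdvd)
      rw [hq]
      exact Splits.prod fun σ _ => Splits.X_sub_C (σ x)
    obtain ⟨y, hy⟩ := hspl.exists_eval_eq_zero (by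
      rw [degree_map]; exact hirr.degree_pos.ne')
    have hyq : (q.map (algebraMap F K)).eval y = 0 :=
      eval_eq_zero_of_dvd_of_eval_eq_zero (Polynomial.map_dvd _ hdvd) hy
    rw [hq, eval_prod, Finset.prod_eq_zero_iff] at hyq
    obtain ⟨σ, -, hσ⟩ := hyq
    rw [eval_sub, eval_X, eval_C, sub_eq_zero] at hσ
    rw [eval_map_algebraMap, hσ, aeval_algHom_apply] at hy
    exact (minpoly.eq_of_irreducible_of_monic hirr
      ((map_eq_zero_iff _ σ.injective).1 hy) hmon)
  have hrep := Multiset.eq_replicate.2 ⟨rfl, hfac⟩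
  have hprod := UniqueFactorizationMonoid.prod_normalizedFactors_eq hq0
  rw [hrep, Multiset.prod_replicate, hqm.normalize_eq_self] at hprod
  have hdq : q.natDegree = Module.finrank F K := by
    rw [← natDegree_map (algebraMap F K), hq, natDegree_prod_of_monic _ _
      fun σ _ => monic_X_sub_C _]
    simp [← IsGalois.card_aut_eq_finrank]
  rw [fieldPoly, ← hprod]
  congr 1
  refine Nat.div_eq_of_eq_mul_left (minpoly.natDegree_pos (.of_finite F x)) ?_
  rw [← hdq]
  conv_lhs => rw [← hprod]
  rw [natDegree_pow]

theorem rootTrace_fieldPoly [IsGalois F K] {g h : F[X]} (hh : h.Monic) (hg : g.degree < h.degree)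
    (x : K) (hx : aeval x h ≠ 0) :
    rootTrace g h (fieldPoly F x) = Algebra.trace F K (aeval x g / aeval x h) := by
  apply (algebraMap F K).injective
  have hσ : ∀ σ : Gal(K/F), (h.map (algebraMap F K)).eval (σ x) ≠ 0 := fun σ => by
    rw [eval_map_algebraMap, aeval_algHom_apply]
    exact (map_ne_zero_iff _ σ.injective).2 hx
  rw [← rootTrace_map _ hh ((isCoprime_fieldPoly_iff F x h).2 hx), map_fieldPoly,
    rootTrace_prod (hh.map _) _ _ fun σ _ => isCoprime_X_sub_C_iff.2 (hσ σ),
    trace_eq_sum_automorphisms]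
  refine Finset.sum_congr rfl fun σ _ => ?_
  rw [rootTrace_X_sub_C (hh.map _) (by simpa [degree_map] using hg) (hσ σ), eval_map_algebraMap,
    eval_map_algebraMap, aeval_algHom_apply, aeval_algHom_apply, map_div₀]

end FieldPolynomial

section Monics

variable (F : Type*) [Field F] [Finite F]

theorem finite_setOf_monic_natDegree_eq (k : ℕ) : {m : F[X] | m.Monic ∧ m.natDegree = k}.Finite := by
  have : Finite (degreeLT F (k + 1)) := Finite.of_equiv _ (degreeLTEquiv F (k + 1)).symm.toEquiv
  refine (Set.toFinite (degreeLT F (k + 1) : Set F[X])).subset fun m hm => ?_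
  rw [SetLike.mem_coe, mem_degreeLT]
  refine lt_of_le_of_lt degree_le_natDegree ?_
  rw [hm.2]
  exact_mod_cast Nat.lt_succ_self k

/-- The monic polynomials of degree `k` over a finite field. -/
def monics (k : ℕ) : Finset F[X] := (finite_setOf_monic_natDegree_eq F k).toFinset

variable {F}

theorem mem_monics {k : ℕ} {m : F[X]} : m ∈ monics F k ↔ m.Monic ∧ m.natDegree = k := by
  simp [monics]

theorem monics_zero : monics F 0 = {1} := by
  ext m
  rw [mem_monics, Finset.mem_singleton]
  constructor
  · rintro ⟨h1, h2⟩; exact h1.natDegree_eq_zero.1 h2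
  · rintro rfl; exact ⟨monic_one, natDegree_one⟩

theorem sum_monics_filter_dvd (χ : F[X] → ℂ) (hχ : ∀ a b, χ (a * b) = χ a * χ b) {c : F[X]}
    (hc : c.Monic) {k : ℕ} (hck : c.natDegree ≤ k) [DecidablePred (c ∣ ·)] :
    ∑ m ∈ (monics F k).filter (c ∣ ·), χ m =
      χ c * ∑ m ∈ monics F (k - c.natDegree), χ m := by
  classical
  have : (monics F k).filter (c ∣ ·) = (monics F (k - c.natDegree)).image (c * ·) := by
    ext m
    simp only [Finset.mem_filter, Finset.mem_image, mem_monics]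
    constructor
    · rintro ⟨⟨hm, hmk⟩, n, rfl⟩
      have hn : n.Monic := hc.of_mul_monic_left hm
      rw [hc.natDegree_mul hn] at hmk
      exact ⟨n, ⟨hn, by omega⟩, rfl⟩
    · rintro ⟨n, ⟨hn, hnk⟩, rfl⟩
      refine ⟨⟨hc.mul hn, ?_⟩, dvd_mul_right _ _⟩
      rw [hc.natDegree_mul hn]; omega
  rw [this, Finset.sum_image fun a _ b _ hab => mul_left_cancel₀ hc.ne_zero hab, Finset.mul_sum]
  exact Finset.sum_congr rfl fun m _ => hχ _ _

theorem sum_monics_eq_zero (χ : F[X] → ℂ) (hχ : ∀ a b, χ (a * b) = χ a * χ b) {N : F[X]}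
    (hN : N.Monic) (hper : ∀ m k, χ (m + N * k) = χ m) {m₀ : F[X]} (h₀ : IsCoprime m₀ N)
    (h₁ : χ m₀ ≠ 1) {k : ℕ} (hk : N.natDegree ≤ k) : ∑ m ∈ monics F k, χ m = 0 := by
  classical
  let T : F[X] → F[X] := fun m => (m₀ * m) %ₘ N + N * (m /ₘ N)
  have hmod : ∀ a b : F[X], (a %ₘ N + N * b) %ₘ N = a %ₘ N := fun a b => by
    rw [add_modByMonic, (modByMonic_eq_self_iff hN).2 (degree_modByMonic_lt _ hN),
      (modByMonic_eq_zero_iff_dvd hN).2 (dvd_mul_right _ _), add_zero]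
  have hmaps : ∀ m ∈ monics F k, T m ∈ monics F k := by
    intro m hm
    rw [mem_monics] at hm ⊢
    have hT : T m = m + ((m₀ * m) %ₘ N - m %ₘ N) := by
      have := modByMonic_add_div m N
      simp only [T]
      linear_combination this
    have hdeg : ((m₀ * m) %ₘ N - m %ₘ N).degree < m.degree := by
      refine (degree_sub_le _ _).trans_lt (max_lt ?_ ?_) <;>
      · refine (degree_modByMonic_lt _ hN).trans_le ?_
        rw [degree_eq_natDegree hN.ne_zero, degree_eq_natDegree hm.1.ne_zero, hm.2]
        exact_mod_cast hk
    rw [hT]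
    exact ⟨hm.1.add_of_left hdeg, by rw [natDegree_add_eq_left_of_degree_lt hdeg, hm.2]⟩
  have hinj : Set.InjOn T (monics F k) := by
    intro a _ b _ hab
    have h1 : (m₀ * a) %ₘ N = (m₀ * b) %ₘ N := by
      rw [← hmod (m₀ * a) (a /ₘ N), ← hmod (m₀ * b) (b /ₘ N)]
      exact congrArg (· %ₘ N) hab
    have h2 : a /ₘ N = b /ₘ N := by
      have h3 : (m₀ * a) %ₘ N + N * (a /ₘ N) = (m₀ * b) %ₘ N + N * (b /ₘ N) := hab
      rw [h1] at h3
      exact mul_left_cancel₀ hN.ne_zero (add_left_cancel h3)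
    have h3 : N ∣ m₀ * (a - b) := by
      rw [← modByMonic_eq_zero_iff_dvd hN, mul_sub, sub_modByMonic, h1, sub_self]
    have h4 := (modByMonic_eq_zero_iff_dvd hN).2 (h₀.symm.dvd_of_dvd_mul_left h3)
    rw [sub_modByMonic, sub_eq_zero] at h4
    rw [← modByMonic_add_div a N, ← modByMonic_add_div b N, h4, h2]
  have hval : ∀ m, χ (T m) = χ m₀ * χ m := by
    intro m
    rw [← hχ, ← modByMonic_add_div (m₀ * m) N]
    simp only [T]
    rw [hper, hper]
  have himg : (monics F k).image T = monics F k :=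
    Finset.eq_of_subset_of_card_le (Finset.image_subset_iff.2 hmaps)
      (Finset.card_image_of_injOn hinj).ge
  have hsum : ∑ m ∈ monics F k, χ m = χ m₀ * ∑ m ∈ monics F k, χ m := by
    conv_lhs => rw [← himg, Finset.sum_image hinj]
    rw [Finset.mul_sum]
    exact Finset.sum_congr rfl fun m _ => hval m
  have : (1 - χ m₀) * ∑ m ∈ monics F k, χ m = 0 := by linear_combination hsum
  exact (mul_eq_zero.1 this).resolve_left (sub_ne_zero.2 h₁.symm)

end Monics

section Counting

open UniqueFactorizationMonoid

theorem card_filter_minpoly_eq {F K : Type*} [Field F] [Finite F] [Field K] [Fintype K]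
    [Algebra F K] {π : F[X]} (hπ : Irreducible π) (hm : π.Monic)
    (hd : π.natDegree ∣ Module.finrank F K) [DecidablePred fun x : K => minpoly F x = π] :
    (Finset.univ.filter fun x : K => minpoly F x = π).card = π.natDegree := by
  classical
  have hF := Fintype.ofFinite F
  have hsplit : (π.map (algebraMap F K)).Splits := by
    refine Splits.of_dvd (FiniteField.isSplittingField_sub K F).splits
      (Polynomial.map_ne_zero (FiniteField.X_pow_card_sub_X_ne_zero _ Fintype.one_lt_card))
      (Polynomial.map_dvd _ ?_)
    rw [Module.card_eq_pow_finrank (K := F), ← Nat.card_eq_fintype_card]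
    exact hπ.natDegree_dvd_iff_dvd_X_pow_card_pow_sub_X.1 hd
  have hroots : (Finset.univ.filter fun x : K => minpoly F x = π) = (π.aroots K).toFinset := by
    ext x
    simp only [Finset.mem_filter, Finset.mem_univ, true_and, Multiset.mem_toFinset,
      mem_aroots]
    constructor
    · rintro rfl; exact ⟨hπ.ne_zero, minpoly.aeval _ _⟩
    · rintro ⟨-, hx⟩; exact (minpoly.eq_of_irreducible_of_monic hπ hx hm).symm
  rw [hroots, Multiset.toFinset_card_of_nodup
    (nodup_roots (PerfectField.separable_of_irreducible hπ).map),
    ← hsplit.natDegree_eq_card_roots, natDegree_map]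

theorem card_filter_fieldPoly_dvd {F K : Type*} [Field F] [Finite F] [Field K] [Fintype K]
    [Algebra F K] {m : F[X]} (hm : m ≠ 0) [DecidableEq F]
    [DecidableRel fun a b : F[X] => a ∣ b] :
    (Finset.univ.filter fun x : K => fieldPoly F x ∣ m).card =
      ∑ π ∈ (normalizedFactors m).toFinset,
        if π.natDegree ∣ Module.finrank F K ∧ π ^ (Module.finrank F K / π.natDegree) ∣ m then
          π.natDegree else 0 := by
  classical
  have hF := Fintype.ofFinite F
  rw [Finset.card_eq_sum_card_fiberwise (f := minpoly F) (t := (normalizedFactors m).toFinset)]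
  · refine Finset.sum_congr rfl fun π hπ => ?_
    rw [Multiset.mem_toFinset] at hπ
    have hirr := irreducible_of_normalized_factor π hπ
    have hmon : π.Monic := by
      rw [← normalize_normalized_factor π hπ]; exact Polynomial.monic_normalize hirr.ne_zero
    rw [Finset.filter_filter]
    split_ifs with hc
    · rw [← card_filter_minpoly_eq (K := K) hirr hmon hc.1]
      congr 1
      refine Finset.filter_congr fun x _ => ⟨fun h => h.2, fun h => ⟨?_, h⟩⟩
      rw [fieldPoly, h]; exact hc.2
    · rw [Finset.card_eq_zero, Finset.filter_eq_empty_iff]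
      rintro x - ⟨h1, rfl⟩
      exact hc ⟨minpoly.degree_dvd (.of_finite F x), h1⟩
  · intro x hx
    simp only [Finset.coe_filter, Finset.mem_univ, true_and, Set.mem_ofPred_eq] at hx
    simp only [Finset.mem_coe, Multiset.mem_toFinset]
    have hint : IsIntegral F x := .of_finite F x
    rw [mem_normalizedFactors_iff' hm]
    refine ⟨minpoly.irreducible hint, (minpoly.monic hint).normalize_eq_self, ?_⟩
    exact (dvd_pow_self _ (Nat.div_pos (minpoly.natDegree_le x)
      (minpoly.natDegree_pos hint)).ne').trans hx

theorem sum_card_filter_fieldPoly_dvd (p : ℕ) [Fact p.Prime] {k : ℕ} {m : (ZMod p)[X]}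
    (hm : m.Monic) (hk : m.natDegree = k) [∀ j, Fintype (GaloisField p j)]
    [DecidableRel fun a b : (ZMod p)[X] => a ∣ b] :
    ∑ j ∈ Finset.Icc 1 k,
      (Finset.univ.filter fun x : GaloisField p j => fieldPoly (ZMod p) x ∣ m).card = k := by
  classical
  have h1 : ∀ j ∈ Finset.Icc 1 k,
      (Finset.univ.filter fun x : GaloisField p j => fieldPoly (ZMod p) x ∣ m).card =
      ∑ π ∈ (normalizedFactors m).toFinset,
        if π.natDegree ∣ j ∧ π ^ (j / π.natDegree) ∣ m then π.natDegree else 0 := by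
    intro j hj
    rw [card_filter_fieldPoly_dvd hm.ne_zero,
      GaloisField.finrank p (by rw [Finset.mem_Icc] at hj; omega)]
  rw [Finset.sum_congr rfl h1, Finset.sum_comm]
  have h2 : ∀ π ∈ (normalizedFactors m).toFinset,
      (∑ j ∈ Finset.Icc 1 k,
        if π.natDegree ∣ j ∧ π ^ (j / π.natDegree) ∣ m then π.natDegree else 0) =
      (normalizedFactors m).count π * π.natDegree := by
    intro π hπ
    rw [Multiset.mem_toFinset] at hπ
    have hirr := irreducible_of_normalized_factor π hπ
    have hpos : 0 < π.natDegree := hirr.natDegree_pos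
    have hpow : ∀ r, π ^ r ∣ m ↔ r ≤ (normalizedFactors m).count π := fun r => by
      rw [pow_dvd_iff_le_emultiplicity, emultiplicity_eq_count_normalizedFactors hirr hm.ne_zero,
        normalize_normalized_factor π hπ, Nat.cast_le]
    rw [← Finset.sum_filter, Finset.sum_const, smul_eq_mul]
    congr 1
    have himg : (Finset.Icc 1 k).filter (fun j => π.natDegree ∣ j ∧ π ^ (j / π.natDegree) ∣ m) =
        (Finset.Icc 1 ((normalizedFactors m).count π)).image (π.natDegree * ·) := by
      ext j
      simp only [Finset.mem_filter, Finset.mem_Icc, Finset.mem_image]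
      constructor
      · rintro ⟨⟨hj1, hjk⟩, ⟨r, rfl⟩, hr⟩
        rw [Nat.mul_div_cancel_left _ hpos, hpow] at hr
        exact ⟨r, ⟨Nat.pos_of_ne_zero (by rintro rfl; omega), hr⟩, rfl⟩
      · rintro ⟨r, ⟨hr1, hr⟩, rfl⟩
        rw [← hpow] at hr
        refine ⟨⟨Nat.mul_pos hpos hr1, ?_⟩, dvd_mul_right _ _, ?_⟩
        · rw [← hk, mul_comm, ← natDegree_pow]
          exact natDegree_le_of_dvd hr hm.ne_zero
        · rwa [Nat.mul_div_cancel_left _ hpos]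
    rw [himg, Finset.card_image_of_injective _ (fun a b h => Nat.eq_of_mul_eq_mul_left hpos h), Nat.card_Icc,
      Nat.add_sub_cancel]
  rw [Finset.sum_congr rfl h2, ← hk]
  conv_rhs => rw [← hm.normalize_eq_self, ← prod_normalizedFactors_eq hm.ne_zero]
  rw [natDegree_multiset_prod _ (zero_notMem_normalizedFactors m), Finset.sum_multiset_map_count]
  simp

end Counting

section Character

variable {F : Type*} [Field F]

/-- The multiplicative character of polynomials `m ↦ ψ (∑ g / h)`, the sum running over the roots
of `m`, extended by zero to the `m` that have a common factor with `h`. -/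
def rootChar (ψ : AddChar F ℂ) (g h m : F[X]) : ℂ :=
  open Classical in if IsCoprime m h then ψ (rootTrace g h m) else 0

variable {ψ : AddChar F ℂ} {g h : F[X]}

theorem rootChar_one (hh : h.Monic) : rootChar ψ g h 1 = 1 := by
  rw [rootChar, if_pos isCoprime_one_left, rootTrace_one hh, AddChar.map_zero_eq_one]

theorem rootChar_mul (hh : h.Monic) (a b : F[X]) :
    rootChar ψ g h (a * b) = rootChar ψ g h a * rootChar ψ g h b := by
  unfold rootChar
  by_cases ha : IsCoprime a h
  · by_cases hb : IsCoprime b h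
    · rw [if_pos (ha.mul_left hb), if_pos ha, if_pos hb, rootTrace_mul hh ha hb,
        AddChar.map_add_eq_mul]
    · rw [if_neg fun hc => hb (IsCoprime.mul_left_iff.1 hc).2, if_neg hb, mul_zero]
  · rw [if_neg fun hc => ha (IsCoprime.mul_left_iff.1 hc).1, if_neg ha, zero_mul]

theorem rootChar_add_sq_mul (hh : h.Monic) (m k : F[X]) :
    rootChar ψ g h (m + h ^ 2 * k) = rootChar ψ g h m := by
  have hiff : IsCoprime (m + h ^ 2 * k) h ↔ IsCoprime m h := by
    rw [pow_two, mul_assoc, IsCoprime.add_mul_left_left_iff]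
  unfold rootChar
  by_cases hc : IsCoprime m h
  · rw [if_pos (hiff.2 hc), if_pos hc, rootTrace_add_sq_mul hh hc]
  · rw [if_neg (mt hiff.1 hc), if_neg hc]

theorem rootChar_fieldPoly {K : Type*} [Field K] [Algebra F K] [FiniteDimensional F K]
    [IsGalois F K] [DecidableEq K] (hh : h.Monic) (hg : g.degree < h.degree) (x : K) :
    rootChar ψ g h (fieldPoly F x) =
      if aeval x h = 0 then 0 else ψ (Algebra.trace F K (aeval x g / aeval x h)) := by
  unfold rootChar
  split_ifs with h1 h2 h2
  · exact absurd h2 ((isCoprime_fieldPoly_iff F x h).1 h1)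
  · rw [rootTrace_fieldPoly F hh hg x h2]
  · rfl
  · exact absurd ((isCoprime_fieldPoly_iff F x h).2 h2) h1

end Character

section Newton

theorem nat_mul_sum_monics {p : ℕ} [Fact p.Prime] [∀ j, Fintype (GaloisField p j)]
    (χ : (ZMod p)[X] → ℂ) (hχ : ∀ a b, χ (a * b) = χ a * χ b) (k : ℕ) :
    (k : ℂ) * ∑ m ∈ monics (ZMod p) k, χ m =
      ∑ j ∈ Finset.Icc 1 k, (∑ x : GaloisField p j, χ (fieldPoly (ZMod p) x)) *
        ∑ m ∈ monics (ZMod p) (k - j), χ m := by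
  classical
  have h1 : ∀ j ∈ Finset.Icc 1 k, (∑ x : GaloisField p j, χ (fieldPoly (ZMod p) x)) *
        ∑ m ∈ monics (ZMod p) (k - j), χ m =
      ∑ m ∈ monics (ZMod p) k, ((Finset.univ.filter
        fun x : GaloisField p j => fieldPoly (ZMod p) x ∣ m).card : ℂ) * χ m := by
    intro j hj
    rw [Finset.mem_Icc] at hj
    have hfr : Module.finrank (ZMod p) (GaloisField p j) = j := GaloisField.finrank p (by omega)
    rw [Finset.sum_mul]
    have h2 : ∀ x : GaloisField p j, χ (fieldPoly (ZMod p) x) *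
        ∑ m ∈ monics (ZMod p) (k - j), χ m =
        ∑ m ∈ monics (ZMod p) k, if fieldPoly (ZMod p) x ∣ m then χ m else 0 := by
      intro x
      rw [← Finset.sum_filter, sum_monics_filter_dvd χ hχ (monic_fieldPoly _ x), natDegree_fieldPoly,
        hfr]
      rw [natDegree_fieldPoly, hfr]
      exact hj.2
    rw [Finset.sum_congr rfl fun x _ => h2 x, Finset.sum_comm]
    refine Finset.sum_congr rfl fun m _ => ?_
    rw [← Finset.sum_filter, Finset.sum_const, nsmul_eq_mul]
  rw [Finset.sum_congr rfl h1, Finset.sum_comm, Finset.mul_sum]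
  refine Finset.sum_congr rfl fun m hm => ?_
  rw [mem_monics] at hm
  rw [← Finset.sum_mul, ← Nat.cast_sum, sum_card_filter_fieldPoly_dvd p hm.1 hm.2]

theorem newton_unique {s S T : ℕ → ℂ} (h0 : s 0 = 1)
    (hS : ∀ k : ℕ, (k : ℂ) * s k = ∑ j ∈ Finset.Icc 1 k, S j * s (k - j))
    (hT : ∀ k : ℕ, (k : ℂ) * s k = ∑ j ∈ Finset.Icc 1 k, T j * s (k - j)) :
    ∀ n, 1 ≤ n → S n = T n := by
  intro n
  induction n using Nat.strong_induction_on with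
  | _ n ih =>
    intro hn
    have h := (hS n).symm.trans (hT n)
    obtain ⟨n, rfl⟩ := Nat.exists_eq_add_of_le' hn
    rw [← Finset.insert_Icc_right_eq_Icc_add_one hn] at h
    have hsum : ∑ j ∈ Finset.Icc 1 n, S j * s (n + 1 - j) =
        ∑ j ∈ Finset.Icc 1 n, T j * s (n + 1 - j) :=
      Finset.sum_congr rfl fun j hj => by
        rw [Finset.mem_Icc] at hj; rw [ih j (by omega) hj.1]
    rw [Finset.sum_insert (by simp), Finset.sum_insert (by simp), Nat.sub_self, h0, mul_one,
      mul_one, hsum] at h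
    exact add_right_cancel h

theorem newton_esymm {n : ℕ} (ω : Fin n → ℂ) (k : ℕ) :
    (k : ℂ) * ((-1) ^ k * MvPolynomial.aeval ω (MvPolynomial.esymm (Fin n) ℂ k)) =
      ∑ j ∈ Finset.Icc 1 k, (-∑ i, ω i ^ j) *
        ((-1) ^ (k - j) * MvPolynomial.aeval ω (MvPolynomial.esymm (Fin n) ℂ (k - j))) := by
  have h := congrArg (MvPolynomial.aeval ω) (MvPolynomial.mul_esymm_eq_sum (Fin n) ℂ k)
  simp only [map_mul, map_natCast, map_pow, map_neg, map_one, map_sum] at h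
  rw [mul_left_comm, h, ← mul_assoc, ← pow_add]
  have hs : (-1 : ℂ) ^ (k + (k + 1)) = -1 := Odd.neg_one_pow ⟨k, by ring⟩
  rw [hs, Finset.mul_sum]
  refine Finset.sum_bij' (fun a _ => a.2) (fun j _ => (k - j, j)) ?_ ?_ ?_ ?_ ?_
  · rintro ⟨a, b⟩ hab
    simp only [Finset.mem_filter, Finset.HasAntidiagonal.mem_antidiagonal] at hab
    rw [Finset.mem_Icc]; omega
  · intro j hj
    rw [Finset.mem_Icc] at hj
    simp only [Finset.mem_filter, Finset.HasAntidiagonal.mem_antidiagonal]; omega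
  · rintro ⟨a, b⟩ hab
    simp only [Finset.mem_filter, Finset.HasAntidiagonal.mem_antidiagonal] at hab
    ext <;> simp; omega
  · intros; rfl
  · rintro ⟨a, b⟩ hab
    simp only [Finset.mem_filter, Finset.HasAntidiagonal.mem_antidiagonal] at hab
    have : k - b = a := by omega
    rw [this]
    simp only [MvPolynomial.psum, map_sum, map_pow, MvPolynomial.aeval_X]
    ring

/-- A sequence related to a finitely supported sequence by Newton's identities consists of
power sums. -/
theorem exists_power_sums {s S : ℕ → ℂ} {D : ℕ} (h0 : s 0 = 1) (hD : ∀ k, D ≤ k → s k = 0)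
    (hS : ∀ k : ℕ, (k : ℂ) * s k = ∑ j ∈ Finset.Icc 1 k, S j * s (k - j)) :
    ∃ ω : Fin D → ℂ, ∀ n, 1 ≤ n → S n = -∑ i, ω i ^ n := by
  let f : ℂ[X] := ∑ k ∈ Finset.range (D + 1), C (s k) * X ^ (D - k)
  have hcoeff : ∀ k, k ≤ D → f.coeff (D - k) = s k := by
    intro k hk
    simp only [f, finsetSum_coeff, coeff_C_mul, coeff_X_pow]
    rw [Finset.sum_eq_single k]
    · simp
    · intro b hb hbk
      rw [Finset.mem_range] at hb
      rw [if_neg (by omega), mul_zero]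
    · intro hk'
      exact absurd (Finset.mem_range.2 (by omega)) hk'
  have hle : f.natDegree ≤ D := by
    refine natDegree_sum_le_of_forall_le _ _ fun k _ => ?_
    exact (natDegree_C_mul_X_pow_le _ _).trans (Nat.sub_le _ _)
  have hlead : f.coeff D = 1 := by simpa [h0] using hcoeff 0 (Nat.zero_le _)
  have hmon : f.Monic := monic_of_natDegree_le_of_coeff_eq_one D hle hlead
  have hdeg : f.natDegree = D :=
    le_antisymm hle (le_natDegree_of_ne_zero (by rw [hlead]; exact one_ne_zero))
  have hsplit : f.Splits := IsAlgClosed.splits f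
  have hcard : Multiset.card f.roots = D := by rw [← hsplit.natDegree_eq_card_roots, hdeg]
  have henum : ∀ t : Multiset ℂ, ∃ ω : Fin (Multiset.card t) → ℂ, Finset.univ.val.map ω = t := by
    intro t
    refine Quotient.inductionOn t fun l => ⟨l.get, ?_⟩
    exact (Fin.univ_val_map _).trans (congrArg _ (List.ofFn_get l))
  obtain ⟨ω, hω⟩ : ∃ ω : Fin D → ℂ, Finset.univ.val.map ω = f.roots := hcard ▸ henum f.roots
  refine ⟨ω, newton_unique h0 hS fun k => ?_⟩
  have hs : ∀ k, s k = (-1) ^ k * MvPolynomial.aeval ω (MvPolynomial.esymm (Fin D) ℂ k) := by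
    intro k
    rw [MvPolynomial.aeval_esymm_eq_multiset_esymm, hω]
    by_cases hk : k ≤ D
    · rw [← hcoeff k hk, Polynomial.coeff_eq_esymm_roots_of_card (by rw [hcard, hdeg])
        (by rw [hdeg]; omega), hmon.leadingCoeff, hdeg, one_mul, Nat.sub_sub_self hk]
    · rw [hD k (by omega), Multiset.esymm, Multiset.powersetCard_eq_empty _ (by omega)]
      simp
  rw [Finset.sum_congr rfl fun j _ => by rw [hs (k - j)], hs k]
  exact newton_esymm ω k

end Newton

section TraceSum

theorem norm_sum_trace_le {p : ℕ} [Fact p.Prime] {K : Type*} [Field K] [Fintype K]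
    [Algebra (ZMod p) K] [DecidableEq K] {M : ℕ} (hcard : Fintype.card K = p ^ (2 * (M + 1)))
    {g h : (ZMod p)[X]} (hh0 : h ≠ 0) (hcop : IsCoprime g h) (hdeg : g.natDegree ≤ h.natDegree)
    (hdp : h.natDegree < p) {α : K} (hα : aeval α h = 0) {ψ : AddChar (ZMod p) ℂ} (hψ : ψ ≠ 1) :
    ‖∑ x : K, if aeval x h = 0 then 0
        else ψ (Algebra.trace (ZMod p) K (aeval x g / aeval x h))‖ ≤
      (p * (2 * h.natDegree + 1) + h.natDegree) * (p : ℝ) ^ (M + 1) := by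
  have hp : 0 < p := (Fact.out : p.Prime).pos
  have hchar : CharP K p := charP_of_injective_algebraMap (algebraMap (ZMod p) K).injective p
  let d := h.natDegree
  let B : ℕ := p ^ (2 * M + 1) + (2 * d + 1) * p ^ (M + 1)
  let A : Finset K := Finset.univ.filter fun x => ¬ aeval x h = 0
  let t : K → ZMod p := fun x => Algebra.trace (ZMod p) K (aeval x g / aeval x h)
  let N : ZMod p → ℕ := fun c => (A.filter fun x => t x = c).card
  have hfr : Module.finrank (ZMod p) K = 2 * (M + 1) := by
    have := Module.card_eq_pow_finrank (K := ZMod p) (V := K)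
    rw [ZMod.card, hcard] at this
    exact (Nat.pow_right_injective (Fact.out : p.Prime).two_le this).symm
  have hN : ∀ c, N c ≤ B := by
    intro c
    have hinj := (algebraMap (ZMod p) K).injective
    have h1 : IsCoprime (g.map (algebraMap (ZMod p) K)) (h.map (algebraMap (ZMod p) K)) :=
      hcop.map (mapRingHom (algebraMap (ZMod p) K))
    have := stepanov_bound M hcard (g.map (algebraMap (ZMod p) K)) (h.map (algebraMap (ZMod p) K))
      ((Polynomial.map_ne_zero_iff hinj).2 hh0) h1
      (by rw [natDegree_map, natDegree_map]; exact hdeg) (by rw [natDegree_map]; exact hdp) α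
      (by rw [IsRoot.def, eval_map_algebraMap, hα]) (algebraMap _ _ c)
      (A.filter fun x => t x = c) ?_
    · rwa [natDegree_map] at this
    · intro x hx
      simp only [A, Finset.mem_filter, Finset.mem_univ, true_and] at hx
      rw [eval_map_algebraMap, eval_map_algebraMap]
      refine ⟨hx.1, ?_⟩
      rw [← hx.2, FiniteField.algebraMap_trace_eq_sum_pow, hfr]
      simp
  have hsumN : ∑ c, N c = A.card :=
    (Finset.card_eq_sum_card_fiberwise fun x _ => Finset.mem_coe.2 (Finset.mem_univ (t x))).symm
  have hA : p ^ (2 * (M + 1)) ≤ A.card + d := by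
    have h1 : (Finset.univ.filter fun x : K => aeval x h = 0).card ≤ d := by
      have hsub : (Finset.univ.filter fun x : K => aeval x h = 0) ⊆ (h.aroots K).toFinset := by
        intro x hx
        rw [Finset.mem_filter] at hx
        rw [Multiset.mem_toFinset, mem_aroots]
        exact ⟨hh0, hx.2⟩
      refine (Finset.card_le_card hsub).trans ((Multiset.toFinset_card_le _).trans ?_)
      exact (card_roots' _).trans natDegree_map_le
    have h2 := Finset.card_filter_add_card_filter_not (s := (Finset.univ : Finset K))
      (fun x : K => aeval x h = 0)
    rw [Finset.card_univ, hcard] at h2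
    change _ + A.card = _ at h2
    omega
  have hS : (∑ x : K, if aeval x h = 0 then 0 else ψ (t x)) =
      ∑ c, ψ c * (((N c : ℝ) - B : ℝ) : ℂ) := by
    have h1 : (∑ x : K, if aeval x h = 0 then 0 else ψ (t x)) = ∑ x ∈ A, ψ (t x) := by
      rw [Finset.sum_filter]
      exact Finset.sum_congr rfl fun x _ => by by_cases hx : aeval x h = 0 <;> simp [hx]
    rw [h1, ← Finset.sum_fiberwise A t]
    have h2 : ∑ c, ψ c * (B : ℂ) = 0 := by
      rw [← Finset.sum_mul, AddChar.sum_eq_zero_of_ne_one hψ, zero_mul]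
    have h3 : ∀ c, ∑ x ∈ A with t x = c, ψ (t x) = ψ c * N c := by
      intro c
      rw [Finset.sum_congr rfl fun x hx => by rw [(Finset.mem_filter.1 hx).2], Finset.sum_const,
        nsmul_eq_mul, mul_comm]
    rw [Finset.sum_congr rfl fun c _ => h3 c]
    push_cast
    simp only [mul_sub, Finset.sum_sub_distrib, h2, sub_zero]
  change ‖∑ x : K, if aeval x h = 0 then 0 else ψ (t x)‖ ≤ _
  rw [hS]
  refine (norm_sum_le _ _).trans ?_
  have h4 : ∀ c, ‖ψ c * (((N c : ℝ) - B : ℝ) : ℂ)‖ = B - N c := by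
    intro c
    rw [norm_mul, AddChar.norm_apply, one_mul, Complex.norm_real, Real.norm_eq_abs, abs_sub_comm,
      abs_of_nonneg]
    exact sub_nonneg.2 (by exact_mod_cast hN c)
  rw [Finset.sum_congr rfl fun c _ => h4 c, Finset.sum_sub_distrib, Finset.sum_const,
    Finset.card_univ, ZMod.card, nsmul_eq_mul, ← Nat.cast_sum, hsumN]
  have hA' : (p : ℝ) ^ (2 * (M + 1)) ≤ A.card + d := by exact_mod_cast hA
  have hB : (p : ℝ) * B = (p : ℝ) ^ (2 * (M + 1)) + p * (2 * d + 1) * (p : ℝ) ^ (M + 1) := by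
    simp only [B]; push_cast; ring
  have h5 : (d : ℝ) ≤ d * (p : ℝ) ^ (M + 1) :=
    le_mul_of_one_le_right (Nat.cast_nonneg _) (one_le_pow₀ (by exact_mod_cast hp))
  rw [hB]
  change _ ≤ ((p : ℝ) * (2 * d + 1) + d) * _
  linarith

end TraceSum

section PowerSums

/-- If all power sums of finitely many complex numbers are `O(R ^ n)`, then each of the numbers
has norm at most `R`. -/
theorem norm_le_of_norm_power_sum_le {ι : Type*} [Fintype ι] (z : ι → ℂ) {A R : ℝ} (hR : 0 < R)
    (hz : ∀ n, 1 ≤ n → ‖∑ i, z i ^ n‖ ≤ A * R ^ n) (i : ι) : ‖z i‖ ≤ R := by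
  classical
  by_contra! hlt
  let q : ℂ[X] := ∏ w ∈ (Finset.univ.image z).erase (z i), (X - C w)
  have hq0 : q.eval (z i) ≠ 0 := by
    rw [eval_prod, Finset.prod_ne_zero_iff]
    intro w hw
    rw [eval_sub, eval_X, eval_C, sub_ne_zero]
    exact (Finset.ne_of_mem_erase hw).symm
  have hq : ∀ j, z j ≠ z i → q.eval (z j) = 0 := by
    intro j hj
    rw [eval_prod, Finset.prod_eq_zero (i := z j)]
    · exact Finset.mem_erase.2 ⟨hj, Finset.mem_image_of_mem _ (Finset.mem_univ j)⟩
    · simp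
  let m : ℕ := (Finset.univ.filter fun j => z j = z i).card
  have hm : 1 ≤ m := Finset.card_pos.2 ⟨i, by simp⟩
  have hkey : ∀ n, ∑ k ∈ Finset.range (q.natDegree + 1), q.coeff k * ∑ j, z j ^ (n + k) =
      m * (z i ^ n * q.eval (z i)) := by
    intro n
    have h1 : ∑ k ∈ Finset.range (q.natDegree + 1), q.coeff k * ∑ j, z j ^ (n + k) =
        ∑ j, z j ^ n * q.eval (z j) := by
      simp only [Finset.mul_sum, eval_eq_sum_range]
      rw [Finset.sum_comm]
      refine Finset.sum_congr rfl fun j _ => Finset.sum_congr rfl fun k _ => ?_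
      rw [pow_add]; ring
    rw [h1, ← nsmul_eq_mul, ← Finset.sum_const, Finset.sum_filter]
    refine Finset.sum_congr rfl fun j _ => ?_
    split_ifs with hj
    · rw [hj]
    · rw [hq j hj, mul_zero]
  let A' : ℝ := ∑ k ∈ Finset.range (q.natDegree + 1), ‖q.coeff k‖ * (A * R ^ k)
  have hbound : ∀ n, 1 ≤ n → (‖z i‖ / R) ^ n ≤ A' / ‖q.eval (z i)‖ := by
    intro n hn
    rw [div_pow, div_le_div_iff₀ (pow_pos hR n) (norm_pos_iff.2 hq0)]
    calc ‖z i‖ ^ n * ‖q.eval (z i)‖ ≤ m * (‖z i‖ ^ n * ‖q.eval (z i)‖) :=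
          le_mul_of_one_le_left (by positivity) (by exact_mod_cast hm)
      _ = ‖∑ k ∈ Finset.range (q.natDegree + 1), q.coeff k * ∑ j, z j ^ (n + k)‖ := by
          rw [hkey]; simp
      _ ≤ ∑ k ∈ Finset.range (q.natDegree + 1), ‖q.coeff k‖ * (A * R ^ (n + k)) := by
          refine (norm_sum_le _ _).trans (Finset.sum_le_sum fun k _ => ?_)
          rw [norm_mul]
          exact mul_le_mul_of_nonneg_left (hz _ (by omega)) (norm_nonneg _)
      _ = A' * R ^ n := by
          rw [Finset.sum_mul]
          exact Finset.sum_congr rfl fun k _ => by rw [pow_add]; ring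
  have h1 : 1 < ‖z i‖ / R := (one_lt_div hR).2 hlt
  obtain ⟨n, hn⟩ := pow_unbounded_of_one_lt (A' / ‖q.eval (z i)‖) h1
  have h2 := hbound (n + 1) (by omega)
  have h3 : (‖z i‖ / R) ^ n ≤ (‖z i‖ / R) ^ (n + 1) := pow_le_pow_right₀ h1.le (Nat.le_succ n)
  linarith

end PowerSums

section ProperFractions

variable {p : ℕ} [Fact p.Prime]

theorem exists_aeval_galoisField_eq_zero {π : (ZMod p)[X]} (hπ : Irreducible π) (hm : π.Monic)
    {n : ℕ} (hn : n ≠ 0) (hd : π.natDegree ∣ n) : ∃ x : GaloisField p n, aeval x π = 0 := by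
  classical
  have : Fintype (GaloisField p n) := Fintype.ofFinite _
  have h1 := card_filter_minpoly_eq (K := GaloisField p n) hπ hm (by rwa [GaloisField.finrank p hn])
  obtain ⟨x, hx⟩ := Finset.card_pos.1 (h1.symm ▸ hπ.natDegree_pos)
  rw [Finset.mem_filter] at hx
  exact ⟨x, by rw [← hx.2]; exact minpoly.aeval _ _⟩

theorem sum_galoisField_one [Fintype (GaloisField p 1)] [DecidableEq (GaloisField p 1)]
    (g h : (ZMod p)[X]) (ψ : AddChar (ZMod p) ℂ) :
    (∑ x : GaloisField p 1, if aeval x h = 0 then 0 else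
        ψ (Algebra.trace (ZMod p) (GaloisField p 1) (aeval x g / aeval x h))) =
      ∑ y : ZMod p, if h.eval y = 0 then 0 else ψ (g.eval y / h.eval y) := by
  refine (Fintype.sum_equiv (GaloisField.equivZmodP p).symm.toEquiv _ _ fun y => ?_).symm
  have hy : (GaloisField.equivZmodP p).symm.toEquiv y = algebraMap _ (GaloisField p 1) y :=
    (GaloisField.equivZmodP p).symm.commutes y
  have hfr : Module.finrank (ZMod p) (GaloisField p 1) = 1 := GaloisField.finrank p one_ne_zero
  rw [hy, aeval_algebraMap_apply, aeval_algebraMap_apply, ← map_div₀, Algebra.trace_algebraMap,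
    hfr, one_smul]
  simp

/-- The Weil bound for exponential sums attached to proper fractions in lowest terms. -/
theorem norm_sum_proper_le {g h : (ZMod p)[X]} (hh : h.Monic) (hcop : IsCoprime g h)
    (hg : g.degree < h.degree) (hpos : 0 < h.natDegree) (hdp : h.natDegree < p)
    {ψ : AddChar (ZMod p) ℂ} (hψ : ψ ≠ 1) :
    ‖∑ y : ZMod p, if h.eval y = 0 then 0 else ψ (g.eval y / h.eval y)‖ ≤
      2 * h.natDegree * √p := by
  classical
  have hp : p.Prime := Fact.out
  have : ∀ j, Fintype (GaloisField p j) := fun j => Fintype.ofFinite _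
  let χ := rootChar ψ g h
  let S : ℕ → ℂ := fun j => ∑ x : GaloisField p j, χ (fieldPoly (ZMod p) x)
  let A : ℕ := p * (2 * h.natDegree + 1) + h.natDegree
  have hdeg : g.natDegree ≤ h.natDegree := natDegree_le_natDegree hg.le
  obtain ⟨π, hπm, hπ, hπh⟩ := exists_monic_irreducible_factor h
    (fun hu => hpos.ne' (natDegree_eq_zero_of_isUnit hu))
  have hr : 0 < π.natDegree := hπ.natDegree_pos
  set r := π.natDegree
  have hSeq : ∀ j, S j = ∑ x : GaloisField p j, if aeval x h = 0 then 0 else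
      ψ (Algebra.trace (ZMod p) (GaloisField p j) (aeval x g / aeval x h)) :=
    fun j => Finset.sum_congr rfl fun x _ => rootChar_fieldPoly hh hg x
  have hroot : ∀ m, 1 ≤ m → ∃ x : GaloisField p (2 * (r * m)), aeval x h = 0 := by
    intro m hm
    obtain ⟨x, hx⟩ := exists_aeval_galoisField_eq_zero hπ hπm (n := 2 * (r * m))
      (by positivity) ⟨2 * m, by ring⟩
    exact ⟨x, aeval_eq_zero_of_dvd_aeval_eq_zero hπh hx⟩
  have hcard : ∀ m, 1 ≤ m → Fintype.card (GaloisField p (2 * (r * m))) = p ^ (2 * (r * m)) := by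
    intro m hm
    rw [← Nat.card_eq_fintype_card, GaloisField.card p _ (by positivity)]
  have hSle : ∀ m, 1 ≤ m → ‖S (2 * (r * m))‖ ≤ A * ((p : ℝ) ^ r) ^ m := by
    intro m hm
    have hα := hroot m hm
    obtain ⟨M, hM⟩ : ∃ M, r * m = M + 1 := Nat.exists_eq_add_of_le' (Nat.mul_pos hr hm)
    rw [hSeq, ← pow_mul, hM]
    have hc := hcard m hm
    rw [hM] at hc hα
    obtain ⟨α, hα⟩ := hα
    have := norm_sum_trace_le hc hh.ne_zero hcop hdeg hdp hα hψ
    simpa [A] using this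
  have hN : (h ^ 2).Monic := hh.pow 2
  have hnontriv : ∃ m₀, IsCoprime m₀ (h ^ 2) ∧ χ m₀ ≠ 1 := by
    by_contra! hall
    have h1 : ∀ m, 1 ≤ m → p ^ (r * m) ≤ h.natDegree + A := by
      intro m hm
      have hK := hcard m hm
      have h2 : S (2 * (r * m)) =
          ((Finset.univ.filter fun x : GaloisField p (2 * (r * m)) => ¬ aeval x h = 0).card : ℂ) := by
        rw [Finset.card_eq_sum_ones, Finset.sum_filter, Nat.cast_sum]
        refine Finset.sum_congr rfl fun x _ => ?_
        by_cases hx : aeval x h = 0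
        · rw [if_neg (not_not.2 hx)]
          change rootChar ψ g h _ = _
          rw [rootChar_fieldPoly hh hg, if_pos hx, Nat.cast_zero]
        · rw [if_pos hx, Nat.cast_one]
          exact hall _ (IsCoprime.pow_right ((isCoprime_fieldPoly_iff _ _ _).2 hx))
      have h3 := hSle m hm
      rw [h2, Complex.norm_natCast, ← pow_mul] at h3
      have h3' : (Finset.univ.filter
          fun x : GaloisField p (2 * (r * m)) => ¬ aeval x h = 0).card ≤ A * p ^ (r * m) := by
        exact_mod_cast h3
      have h4 : (Finset.univ.filter
          fun x : GaloisField p (2 * (r * m)) => aeval x h = 0).card ≤ h.natDegree := by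
        have hsub : (Finset.univ.filter fun x : GaloisField p (2 * (r * m)) => aeval x h = 0) ⊆
            (h.aroots (GaloisField p (2 * (r * m)))).toFinset := by
          intro x hx
          rw [Finset.mem_filter] at hx
          rw [Multiset.mem_toFinset, mem_aroots]
          exact ⟨hh.ne_zero, hx.2⟩
        refine (Finset.card_le_card hsub).trans ((Multiset.toFinset_card_le _).trans ?_)
        exact (card_roots' _).trans natDegree_map_le
      have h5 := Finset.card_filter_add_card_filter_not
        (s := (Finset.univ : Finset (GaloisField p (2 * (r * m))))) (fun x => aeval x h = 0)
      rw [Finset.card_univ, hK] at h5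
      have h6 : 0 < p ^ (r * m) := pow_pos hp.pos _
      have h7 : p ^ (2 * (r * m)) = p ^ (r * m) * p ^ (r * m) := by rw [← pow_add]; ring_nf
      have h8 : p ^ (r * m) * p ^ (r * m) ≤ (h.natDegree + A) * p ^ (r * m) := by
        nlinarith
      exact Nat.le_of_mul_le_mul_right h8 h6
    have h2 := h1 (h.natDegree + A + 1) (by omega)
    have h3 : h.natDegree + A + 1 < p ^ (h.natDegree + A + 1) := Nat.lt_pow_self hp.one_lt
    have h4 : p ^ (h.natDegree + A + 1) ≤ p ^ (r * (h.natDegree + A + 1)) :=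
      Nat.pow_le_pow_right hp.pos (Nat.le_mul_of_pos_left _ hr)
    omega
  obtain ⟨m₀, hm₀, hχ₀⟩ := hnontriv
  obtain ⟨ω, hω⟩ := exists_power_sums (s := fun k => ∑ m ∈ monics (ZMod p) k, χ m) (S := S)
    (D := (h ^ 2).natDegree) (by simpa [monics_zero] using rootChar_one hh)
    (fun k hk => sum_monics_eq_zero χ (rootChar_mul hh) hN (rootChar_add_sq_mul hh) hm₀ hχ₀ hk)
    (nat_mul_sum_monics χ (rootChar_mul hh))
  have hωle : ∀ i, ‖ω i‖ ≤ √p := by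
    intro i
    have h1 := norm_le_of_norm_power_sum_le (fun i => ω i ^ (2 * r)) (A := A) (R := (p : ℝ) ^ r)
      (pow_pos (by exact_mod_cast hp.pos) _) (fun n hn => by
        have h2 := hSle n hn
        rw [hω _ (Nat.mul_pos two_pos (Nat.mul_pos hr hn)), norm_neg] at h2
        simpa [← pow_mul, mul_assoc] using h2) i
    have h2 : (p : ℝ) ^ r = √p ^ (2 * r) := by
      rw [pow_mul, Real.sq_sqrt (Nat.cast_nonneg _)]
    rw [norm_pow, h2] at h1
    exact (pow_le_pow_iff_left₀ (norm_nonneg _) (Real.sqrt_nonneg _) (by omega)).1 h1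
  rw [← sum_galoisField_one, ← hSeq, hω 1 le_rfl, norm_neg]
  refine (norm_sum_le _ _).trans ((Finset.sum_le_sum fun i _ => ?_).trans_eq
    (Finset.sum_const (√(p : ℝ))) |>.trans_eq ?_)
  · rw [pow_one]; exact hωle i
  · rw [Finset.card_univ, Fintype.card_fin, natDegree_pow, nsmul_eq_mul]; push_cast; ring

end ProperFractions

section Fractions

theorem exists_isCoprime_mul_eq {F : Type*} [Field F] (g : F[X]) {h : F[X]} (hh : h ≠ 0) :
    ∃ g' h' u, IsCoprime g' h' ∧ g = u * g' ∧ h = u * h' := by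
  classical
  obtain ⟨g', hg'⟩ := EuclideanDomain.gcd_dvd_left g h
  obtain ⟨h', hh'⟩ := EuclideanDomain.gcd_dvd_right g h
  have hab := EuclideanDomain.gcd_eq_gcd_ab g h
  set u := EuclideanDomain.gcd g h
  have hu : u ≠ 0 := by rintro h0; rw [h0, zero_mul] at hh'; exact hh hh'
  refine ⟨g', h', u, ⟨EuclideanDomain.gcdA g h, EuclideanDomain.gcdB g h, ?_⟩, hg', hh'⟩
  refine mul_left_cancel₀ hu ?_
  generalize EuclideanDomain.gcdA g h = a at *
  generalize EuclideanDomain.gcdB g h = b at *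
  linear_combination -hab - a * hg' - b * hh'

theorem norm_sum_le_norm_sum_add {ι : Type*} [Fintype ι] {u v : ι → ℂ} (hu : ∀ x, ‖u x‖ ≤ 1)
    (hv : ∀ x, ‖v x‖ ≤ 1) (s : Finset ι) (huv : ∀ x, x ∉ s → u x = v x) :
    ‖∑ x, u x‖ ≤ ‖∑ x, v x‖ + 2 * s.card := by
  classical
  have h1 : ∑ x, u x = ∑ x, v x + ∑ x ∈ s, (u x - v x) := by
    rw [Finset.sum_subset (Finset.subset_univ s) fun x _ hx => by rw [huv x hx, sub_self],
      Finset.sum_sub_distrib]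
    ring
  rw [h1]
  refine (norm_add_le _ _).trans (add_le_add_right ?_ _)
  refine (norm_sum_le_of_le s (f := fun x => u x - v x) (n := fun _ => 2) fun x _ => ?_).trans_eq ?_
  · exact (norm_sub_le _ _).trans (by linarith [hu x, hv x])
  · rw [Finset.sum_const, nsmul_eq_mul, mul_comm]

variable {p : ℕ} [Fact p.Prime]

/-- `ψ (g / h)` as a function, extended by zero to the zeros of `h`. -/
def fracChar (ψ : AddChar (ZMod p) ℂ) (g h : (ZMod p)[X]) (y : ZMod p) : ℂ :=
  if h.eval y = 0 then 0 else ψ (g.eval y / h.eval y)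

variable {ψ : AddChar (ZMod p) ℂ} {g h : (ZMod p)[X]}

theorem norm_fracChar_le (y : ZMod p) : ‖fracChar ψ g h y‖ ≤ 1 := by
  unfold fracChar
  split_ifs
  · simp
  · rw [AddChar.norm_apply]

theorem card_rootSet_filter_le (hh : h ≠ 0) :
    (Finset.univ.filter fun y : ZMod p => h.eval y = 0).card ≤ h.natDegree := by
  classical
  have hsub : (Finset.univ.filter fun y : ZMod p => h.eval y = 0) ⊆ h.roots.toFinset := by
    intro x hx
    rw [Finset.mem_filter] at hx
    rw [Multiset.mem_toFinset, mem_roots hh]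
    exact hx.2
  exact (Finset.card_le_card hsub).trans ((Multiset.toFinset_card_le _).trans (card_roots' _))

theorem norm_sum_fracChar_proper_le {D : ℕ} (hg0 : g ≠ 0) (hg : g.degree < h.degree)
    (hhD : h.natDegree ≤ D) (hDp : D < p) (hψ : ψ ≠ 1) :
    ‖∑ y, fracChar ψ g h y‖ ≤ 2 * D * √p + 2 * D := by
  classical
  have hh0 : h ≠ 0 := by rintro rfl; simp at hg
  obtain ⟨g', h', u, hcop, rfl, rfl⟩ := exists_isCoprime_mul_eq g hh0
  have hu : u ≠ 0 := left_ne_zero_of_mul hh0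
  have hh' : h' ≠ 0 := right_ne_zero_of_mul hh0
  have hg' : g' ≠ 0 := right_ne_zero_of_mul hg0
  set c := h'.leadingCoeff with hcdef
  have hc : c ≠ 0 := leadingCoeff_ne_zero.2 hh'
  have hdeg : g'.natDegree < h'.natDegree := by
    have := natDegree_lt_natDegree hg0 hg
    rw [natDegree_mul hu hg', natDegree_mul hu hh'] at this
    omega
  have hdu : u.natDegree + h'.natDegree ≤ D := by rwa [natDegree_mul hu hh'] at hhD
  have hnat : (h' * C c⁻¹).natDegree = h'.natDegree := natDegree_mul_C (inv_ne_zero hc)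
  have hunit : IsUnit (C c⁻¹ : (ZMod p)[X]) := isUnit_C.2 (inv_ne_zero hc).isUnit
  have hmain : ‖∑ y, fracChar ψ (g' * C c⁻¹) (h' * C c⁻¹) y‖ ≤ 2 * h'.natDegree * √p := by
    have := norm_sum_proper_le (g := g' * C c⁻¹) (monic_mul_leadingCoeff_inv hh')
      ((isCoprime_mul_unit_right hunit _ _).2 hcop)
      (by
        rw [degree_mul_C (inv_ne_zero hc), degree_mul_C (inv_ne_zero hc)]
        exact degree_lt_degree hdeg) (by rw [hnat]; omega) (by rw [hnat]; omega) hψ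
    rwa [hnat] at this
  have hdiff := norm_sum_le_norm_sum_add (u := fracChar ψ (u * g') (u * h'))
    (v := fracChar ψ (g' * C c⁻¹) (h' * C c⁻¹)) norm_fracChar_le norm_fracChar_le
    (Finset.univ.filter fun y : ZMod p => u.eval y = 0) (fun y hy => by
      simp only [Finset.mem_filter, Finset.mem_univ, true_and] at hy
      simp only [fracChar, eval_mul, eval_C, mul_eq_zero, hy, inv_eq_zero, hc, false_or, or_false]
      rw [mul_div_mul_left _ _ hy, mul_div_mul_right _ _ (inv_ne_zero hc)])
  have hcardu : ((Finset.univ.filter fun y : ZMod p => u.eval y = 0).card : ℝ) ≤ D := by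
    exact_mod_cast (card_rootSet_filter_le hu).trans (by omega)
  have hh'D : (h'.natDegree : ℝ) ≤ D := by exact_mod_cast (by omega : h'.natDegree ≤ D)
  have := mul_le_mul_of_nonneg_right hh'D (Real.sqrt_nonneg (p : ℝ))
  linarith

/-- The Weil bound for exponential sums attached to rational functions of bounded degree. -/
theorem norm_sum_fracChar_le {D : ℕ} (hh : h ≠ 0) (hgD : g.natDegree ≤ D) (hhD : h.natDegree ≤ D)
    (hDp : D < p) (hgh : ∀ c : ZMod p, g ≠ C c * h) (hψ : ψ ≠ 1) :
    ‖∑ y, fracChar ψ g h y‖ ≤ 2 * D * √p + 2 * D + 2 := by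
  classical
  obtain ⟨b, hb⟩ : ∃ b, h.eval b ≠ 0 := by
    by_contra! hall
    have := card_rootSet_filter_le hh
    rw [Finset.filter_true_of_mem fun y _ => hall y, Finset.card_univ, ZMod.card] at this
    omega
  set c := g.eval b / h.eval b with hc
  let g₁ := (g - C c * h).comp (X + C b)
  let h₁ := h.comp (X + C b)
  have hcompdeg : ∀ f : (ZMod p)[X], (f.comp (X + C b)).natDegree = f.natDegree := fun f => by
    rw [natDegree_comp, natDegree_X_add_C, mul_one]
  have hg₁D : g₁.natDegree ≤ D := by
    rw [hcompdeg]
    refine (natDegree_sub_le _ _).trans (max_le hgD ?_)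
    exact (natDegree_C_mul_le _ _).trans hhD
  have hh₁D : h₁.natDegree ≤ D := by rw [hcompdeg]; exact hhD
  have hg₁ : g₁ ≠ 0 := by
    intro h0
    have : g - C c * h = 0 := by
      have h2 := congrArg (fun f => f.comp (X - C b)) h0
      simpa [g₁, comp_assoc] using h2
    exact hgh c (sub_eq_zero.1 this)
  have hg₁0 : g₁.coeff 0 = 0 := by
    rw [coeff_zero_eq_eval_zero]
    simp [g₁, hc, hb]
  have hh₁0 : h₁.coeff 0 ≠ 0 := by
    rw [coeff_zero_eq_eval_zero]
    simpa [h₁] using hb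
  have heval : ∀ f : (ZMod p)[X], f.natDegree ≤ D → ∀ z : ZMod p, z ≠ 0 →
      f.eval z⁻¹ = (f.reflect D).eval z * z⁻¹ ^ D := by
    intro f hf z hz
    let inv : Invertible z⁻¹ := invertibleOfNonzero (inv_ne_zero hz)
    have := eval₂_reflect_mul_pow (RingHom.id (ZMod p)) z⁻¹ D f hf
    rw [invOf_eq_inv, inv_inv] at this
    exact this.symm
  have hrg : g₁.reflect D ≠ 0 := reflect_eq_zero_iff.not.2 hg₁
  have hcoeffD : ∀ f : (ZMod p)[X], (f.reflect D).coeff D = f.coeff 0 := fun f => by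
    rw [coeff_reflect, revAt_le le_rfl, Nat.sub_self]
  have hdegle : ∀ f : (ZMod p)[X], f.natDegree ≤ D → (f.reflect D).natDegree ≤ D := by
    intro f hf
    rw [natDegree_le_iff_coeff_eq_zero]
    intro N hN
    rw [coeff_reflect, revAt_eq_self_of_lt hN]
    exact coeff_eq_zero_of_natDegree_lt (hf.trans_lt hN)
  have hdegh : (h₁.reflect D).natDegree = D :=
    le_antisymm (hdegle _ hh₁D) (le_natDegree_of_ne_zero (by rw [hcoeffD]; exact hh₁0))
  have hdegg : (g₁.reflect D).degree < (h₁.reflect D).degree := by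
    have hrh : h₁.reflect D ≠ 0 := by
      intro h0; apply hh₁0; rw [← hcoeffD, h0, coeff_zero]
    rw [degree_eq_natDegree hrh, hdegh]
    refine lt_of_le_of_ne (natDegree_le_iff_degree_le.1 (hdegle _ hg₁D)) fun he => ?_
    have := coeff_ne_zero_of_eq_degree he
    rw [hcoeffD] at this
    exact this hg₁0
  have hmain := norm_sum_fracChar_proper_le hrg hdegg hdegh.le hDp hψ
  let e : ZMod p ≃ ZMod p := (Equiv.inv (ZMod p)).trans (Equiv.addLeft b)
  have hsum : ∑ y, fracChar ψ g h y = ψ c * ∑ z, (ψ c)⁻¹ * fracChar ψ g h (b + z⁻¹) := by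
    rw [Finset.mul_sum, ← Equiv.sum_comp e]
    refine Finset.sum_congr rfl fun z _ => ?_
    rw [mul_inv_cancel_left₀ (by
      intro h0; simpa [h0] using AddChar.norm_apply ψ c)]
    rfl
  have hdiff := norm_sum_le_norm_sum_add (u := fun z => (ψ c)⁻¹ * fracChar ψ g h (b + z⁻¹))
    (v := fracChar ψ (g₁.reflect D) (h₁.reflect D))
    (fun z => by
      rw [norm_mul, norm_inv, AddChar.norm_apply, inv_one, one_mul]; exact norm_fracChar_le _)
    norm_fracChar_le {0} (fun z hz => by
      rw [Finset.mem_singleton] at hz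
      have h1 : h.eval (b + z⁻¹) = (h₁.reflect D).eval z * z⁻¹ ^ D := by
        rw [← heval _ hh₁D z hz]; simp [h₁, add_comm]
      have h2 : g.eval (b + z⁻¹) - c * h.eval (b + z⁻¹) = (g₁.reflect D).eval z * z⁻¹ ^ D := by
        rw [← heval _ hg₁D z hz]; simp [g₁, add_comm]
      have hzD : z⁻¹ ^ D ≠ 0 := pow_ne_zero _ (inv_ne_zero hz)
      simp only [fracChar]
      by_cases h0 : (h₁.reflect D).eval z = 0
      · rw [if_pos h0, if_pos (by rw [h1, h0, zero_mul]), mul_zero]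
      · have h0' : h.eval (b + z⁻¹) ≠ 0 := by rw [h1]; exact mul_ne_zero h0 hzD
        rw [if_neg h0, if_neg h0', ← AddChar.map_neg_eq_inv, ← AddChar.map_add_eq_mul]
        congr 1
        rw [← mul_div_mul_right (eval z (g₁.reflect D)) _ hzD, ← h1, ← h2, sub_div,
          mul_div_cancel_right₀ _ h0']
        ring)
  rw [Finset.card_singleton, Nat.cast_one] at hdiff
  rw [hsum, norm_mul, AddChar.norm_apply, one_mul]
  linarith

end Fractions

section Reduction

theorem exists_integer_multiples_rat {ι : Type*} (s : Finset ι) (q : ι → ℚ) :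
    ∃ M : ℤ, M ≠ 0 ∧ ∀ i ∈ s, ∃ r : ℤ, (r : ℚ) = M * q i := by
  obtain ⟨b, hb⟩ := IsLocalization.exist_integer_multiples (nonZeroDivisors ℤ) s q
  refine ⟨b, nonZeroDivisors.coe_ne_zero b, fun i hi => ?_⟩
  obtain ⟨r, hr⟩ := hb i hi
  exact ⟨r, by simpa [Algebra.smul_def] using hr⟩

theorem exists_int_polynomials {ι : Type*} [Fintype ι] (f : ι → ℚ[X]) :
    ∃ (N : ℤ) (G : ι → ℤ[X]), N ≠ 0 ∧
      ∀ i, (G i).map (Int.castRingHom ℚ) = C (N : ℚ) * f i := by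
  obtain ⟨N, hN, h⟩ := exists_integer_multiples_rat
    (Finset.univ.sigma fun i => (f i).support) (fun x => (f x.1).coeff x.2)
  have h1 : ∀ i, C (N : ℚ) * f i ∈ lifts (Int.castRingHom ℚ) := by
    intro i
    rw [lifts_iff_coeff_lifts]
    intro n
    rw [coeff_C_mul]
    by_cases hn : n ∈ (f i).support
    · obtain ⟨r, hr⟩ := h ⟨i, n⟩ (Finset.mem_sigma.2 ⟨Finset.mem_univ _, hn⟩)
      exact ⟨r, hr⟩
    · rw [notMem_support_iff.1 hn, mul_zero]
      exact ⟨0, map_zero _⟩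
  choose G hG using fun i => (mem_lifts _).1 (h1 i)
  exact ⟨N, G, hN, hG⟩

/-- Linear independence over `ℚ` of integral polynomials is inherited by their reductions modulo
all primes not dividing some fixed nonzero integer. -/
theorem exists_linearIndependent_map {ι : Type*} [Fintype ι] (v : ι → ℤ[X])
    (hv : LinearIndependent ℚ fun i => (v i).map (Int.castRingHom ℚ)) :
    ∃ M : ℤ, M ≠ 0 ∧ ∀ (p : ℕ) [Fact p.Prime], (M : ZMod p) ≠ 0 →
      LinearIndependent (ZMod p) fun i => (v i).map (Int.castRingHom (ZMod p)) := by
  classical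
  obtain ⟨φ, hφ⟩ := LinearMap.exists_leftInverse_of_injective
    (Fintype.linearCombination ℚ fun i => (v i).map (Int.castRingHom ℚ))
    (LinearMap.ker_eq_bot.2 (linearIndependent_iff_injective_fintypeLinearCombination.1 hv))
  have hφv : ∀ i, φ ((v i).map (Int.castRingHom ℚ)) = Pi.single i 1 := by
    intro i
    have := LinearMap.congr_fun hφ (Pi.single i 1)
    simpa [Fintype.linearCombination_apply_single] using this
  let D := Finset.univ.sup fun i => (v i).natDegree
  obtain ⟨M, hM, hint⟩ := exists_integer_multiples_rat
    ((Finset.univ : Finset ι) ×ˢ Finset.range (D + 1)) (fun x => φ (X ^ x.2) x.1)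
  have hint' : ∀ x : ι × ℕ, ∃ r : ℤ, x.2 < D + 1 → (r : ℚ) = M * φ (X ^ x.2) x.1 := by
    intro x
    by_cases hx : x.2 < D + 1
    · obtain ⟨r, hr⟩ := hint x (Finset.mem_product.2 ⟨Finset.mem_univ _, Finset.mem_range.2 hx⟩)
      exact ⟨r, fun _ => hr⟩
    · exact ⟨0, fun h => absurd h hx⟩
  choose t ht using hint'
  have hdual : ∀ i j, ∑ k ∈ Finset.range (D + 1), (v i).coeff k * t (j, k) =
      if i = j then M else 0 := by
    intro i j
    have h1 : (v i).map (Int.castRingHom ℚ) =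
        ∑ k ∈ Finset.range (D + 1), ((v i).coeff k : ℚ) • (X : ℚ[X]) ^ k := by
      rw [as_sum_range_C_mul_X_pow' (p := (v i).map (Int.castRingHom ℚ)) (n := D + 1)]
      · simp [smul_eq_C_mul]
      · exact natDegree_map_le.trans_lt
          (Nat.lt_succ_of_le (Finset.le_sup (f := fun i => (v i).natDegree) (Finset.mem_univ i)))
    have h2 := congrFun (hφv i) j
    rw [h1, map_sum, Finset.sum_apply] at h2
    have h3 : ((∑ k ∈ Finset.range (D + 1), (v i).coeff k * t (j, k) : ℤ) : ℚ) =
        M * (Pi.single i (1 : ℚ) : ι → ℚ) j := by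
      rw [← h2, Finset.mul_sum]
      push_cast
      refine Finset.sum_congr rfl fun k hk => ?_
      rw [ht (j, k) (Finset.mem_range.1 hk), map_smul, Pi.smul_apply, smul_eq_mul]
      ring
    rw [Pi.single_apply] at h3
    split_ifs at h3 with h4
    · rw [if_pos h4.symm]; rw [mul_one] at h3; exact_mod_cast h3
    · rw [if_neg (Ne.symm h4)]; rw [mul_zero] at h3; exact_mod_cast h3
  refine ⟨M, hM, fun p _ hMp => Fintype.linearIndependent_iff.2 fun c hc j => ?_⟩
  have h1 : ∀ k, ∑ i, c i * ((v i).coeff k : ZMod p) = 0 := by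
    intro k
    have := congrArg (fun f => f.coeff k) hc
    simpa [finsetSum_coeff] using this
  have h2 : ∑ k ∈ Finset.range (D + 1), (∑ i, c i * ((v i).coeff k : ZMod p)) * (t (j, k) : ZMod p)
      = c j * M := by
    simp only [Finset.sum_mul]
    rw [Finset.sum_comm]
    have h3 : ∀ i, ∑ k ∈ Finset.range (D + 1),
        c i * ((v i).coeff k : ZMod p) * (t (j, k) : ZMod p) = if i = j then c i * M else 0 := by
      intro i
      have := congrArg (Int.cast : ℤ → ZMod p) (hdual i j)
      push_cast at this
      simp only [mul_assoc]
      rw [← Finset.mul_sum, this]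
      split_ifs <;> simp
    rw [Finset.sum_congr rfl fun i _ => h3 i]
    simp
  rw [Finset.sum_eq_zero fun k _ => by rw [h1 k, zero_mul]] at h2
  exact (mul_eq_zero.1 h2.symm).resolve_right hMp

theorem map_eq_C_mul_polyRed {p : ℕ} [Fact p.Prime] {N : ℤ} {f : ℚ[X]} {G : ℤ[X]}
    (hG : G.map (Int.castRingHom ℚ) = C (N : ℚ) * f) (hN : (N : ZMod p) ≠ 0) :
    G.map (Int.castRingHom (ZMod p)) = C (N : ZMod p) * polyRed p f := by
  have hcoeff : ∀ n, (polyRed p f).coeff n = ratRed p (f.coeff n) := by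
    intro n
    rw [polyRed, Polynomial.sum, finsetSum_coeff]
    simp only [coeff_C_mul_X_pow]
    rw [Finset.sum_ite_eq]
    split_ifs with h
    · rfl
    · rw [notMem_support_iff.1 h]; simp [ratRed]
  ext n
  rw [coeff_map, coeff_C_mul, hcoeff]
  have h1 := congrArg (fun f => f.coeff n) hG
  simp only [coeff_map, coeff_C_mul, eq_intCast] at h1
  set q := f.coeff n
  have h2 : G.coeff n * (q.den : ℤ) = N * q.num := by
    have h3 : (G.coeff n : ℚ) * q.den = N * q.num := by
      rw [h1, mul_assoc, Rat.mul_den_eq_num]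
    exact_mod_cast h3
  have h4 : (G.coeff n : ZMod p) * (q.den : ZMod p) = N * q.num := by
    have := congrArg (Int.cast : ℤ → ZMod p) h2
    exact_mod_cast this
  have hden : (q.den : ZMod p) ≠ 0 := by
    intro h0
    rw [h0, mul_zero, eq_comm, mul_eq_zero, or_iff_right hN,
      ZMod.intCast_zmod_eq_zero_iff_dvd, Int.natCast_dvd] at h4
    rw [ZMod.natCast_eq_zero_iff] at h0
    exact Nat.not_coprime_of_dvd_of_dvd (Fact.out : p.Prime).one_lt h4 h0 q.reduced
  rw [eq_intCast, ratRed, ← mul_assoc, ← h4, mul_inv_cancel_right₀ hden]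

theorem linearIndependent_cross_products (P Q : RatFunc ℚ)
    (hPQ : LinearIndependent ℚ ![P, Q, (1 : RatFunc ℚ)]) :
    LinearIndependent ℚ ![P.num * Q.denom, Q.num * P.denom, P.denom * Q.denom] := by
  rw [Fintype.linearIndependent_iff] at hPQ ⊢
  intro c hc
  refine hPQ c ?_
  have hP : algebraMap ℚ[X] (RatFunc ℚ) P.denom ≠ 0 := RatFunc.algebraMap_ne_zero P.denom_ne_zero
  have hQ : algebraMap ℚ[X] (RatFunc ℚ) Q.denom ≠ 0 := RatFunc.algebraMap_ne_zero Q.denom_ne_zero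
  have h1 := congrArg (algebraMap ℚ[X] (RatFunc ℚ)) hc
  simp only [Fin.sum_univ_three, Matrix.cons_val_zero, Matrix.cons_val_one, Matrix.cons_val,
    map_add, map_zero, Algebra.smul_def, map_mul] at h1 ⊢
  have hPn : P * algebraMap ℚ[X] (RatFunc ℚ) P.denom = algebraMap ℚ[X] (RatFunc ℚ) P.num :=
    (div_eq_iff hP).1 (RatFunc.num_div_denom P) |>.symm
  have hQn : Q * algebraMap ℚ[X] (RatFunc ℚ) Q.denom = algebraMap ℚ[X] (RatFunc ℚ) Q.num :=
    (div_eq_iff hQ).1 (RatFunc.num_div_denom Q) |>.symm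
  rw [← hPn, ← hQn] at h1
  refine (mul_eq_zero.1 (?_ : _ * (algebraMap ℚ[X] (RatFunc ℚ) P.denom *
    algebraMap ℚ[X] (RatFunc ℚ) Q.denom) = 0)).resolve_right (mul_ne_zero hP hQ)
  simp only [IsScalarTower.algebraMap_apply ℚ ℚ[X] (RatFunc ℚ)]
  linear_combination h1

end Reduction

section CornerSums

theorem ep_eq_stdAddChar {p : ℕ} [NeZero p] (x : ZMod p) : ep p x = ZMod.stdAddChar x := by
  rw [ep, ZMod.stdAddChar_apply, ZMod.toCircle_apply]

theorem stdAddChar_ne_one {p : ℕ} [Fact p.Prime] : (ZMod.stdAddChar : AddChar (ZMod p) ℂ) ≠ 1 := by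
  intro h
  have h1 : (ZMod.stdAddChar (1 : ZMod p) : ℂ) = ZMod.stdAddChar (0 : ZMod p) := by rw [h]; rfl
  exact one_ne_zero (ZMod.injective_stdAddChar h1)

theorem norm_ep {p : ℕ} [NeZero p] (x : ZMod p) : ‖ep p x‖ = 1 := by
  rw [ep_eq_stdAddChar, AddChar.norm_apply]

/-- The exponential sum of `a P + b Q` over the non-poles of `P` and `Q`. -/
def nonpoleSum (p : ℕ) [NeZero p] (P Q : RatFunc ℚ) (a b : ZMod p) : ℂ :=
  ∑ y : ZMod p, if ¬ IsPole p P y ∧ ¬ IsPole p Q y then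
    ep p (a * evalRed p P y + b * evalRed p Q y) else 0

theorem norm_nonpoleSum_le {p : ℕ} [NeZero p] (P Q : RatFunc ℚ) (a b : ZMod p) :
    ‖nonpoleSum p P Q a b‖ ≤ p := by
  refine (norm_sum_le_of_le _ (n := fun _ => 1) fun y _ => ?_).trans_eq (by simp)
  split_ifs
  · exact (norm_ep _).le
  · simp

theorem exists_nonpoleSum_eq (P Q : RatFunc ℚ)
    (hPQ : LinearIndependent ℚ ![P, Q, (1 : RatFunc ℚ)]) :
    ∃ D p₀ : ℕ, ∀ (p : ℕ) [Fact p.Prime], p₀ < p →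
      ∃ g₁ g₂ h : (ZMod p)[X], g₁.natDegree ≤ D ∧ g₂.natDegree ≤ D ∧ h.natDegree ≤ D ∧
        LinearIndependent (ZMod p) ![g₁, g₂, h] ∧
        ∀ a b, nonpoleSum p P Q a b =
          ∑ y, fracChar ZMod.stdAddChar (C a * g₁ + C b * g₂) h y := by
  obtain ⟨N, G, hN, hG⟩ := exists_int_polynomials ![P.num, P.denom, Q.num, Q.denom]
  have hG0 : (G 0).map (Int.castRingHom ℚ) = C (N : ℚ) * P.num := hG 0
  have hG1 : (G 1).map (Int.castRingHom ℚ) = C (N : ℚ) * P.denom := hG 1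
  have hG2 : (G 2).map (Int.castRingHom ℚ) = C (N : ℚ) * Q.num := hG 2
  have hG3 : (G 3).map (Int.castRingHom ℚ) = C (N : ℚ) * Q.denom := hG 3
  let v : Fin 3 → ℤ[X] := ![G 0 * G 3, G 2 * G 1, G 1 * G 3]
  have hv : LinearIndependent ℚ fun i => (v i).map (Int.castRingHom ℚ) := by
    have hNQ : ((N : ℚ) * N) ≠ 0 := mul_ne_zero (by exact_mod_cast hN) (by exact_mod_cast hN)
    have := (linearIndependent_cross_products P Q hPQ).units_smul fun _ => Units.mk0 _ hNQ
    convert this using 1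
    ext1 i
    simp only [Pi.smul_apply', Units.smul_mk0, smul_eq_C_mul, C_mul]
    fin_cases i
    · simp [v, hG0, hG3]; ring
    · simp [v, hG1, hG2]; ring
    · simp [v, hG1, hG3]; ring
  obtain ⟨M, hM, hind⟩ := exists_linearIndependent_map v hv
  refine ⟨(v 0).natDegree + (v 1).natDegree + (v 2).natDegree, N.natAbs + M.natAbs, ?_⟩
  intro p _ hp
  have hcast : ∀ m : ℤ, m ≠ 0 → m.natAbs < p → (m : ZMod p) ≠ 0 := by
    intro m hm hlt h0
    rw [ZMod.intCast_zmod_eq_zero_iff_dvd, Int.natCast_dvd] at h0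
    exact absurd (Nat.le_of_dvd (Int.natAbs_pos.2 hm) h0) (by omega)
  have hNp := hcast N hN (by omega)
  have e0 := map_eq_C_mul_polyRed hG0 hNp
  have e1 := map_eq_C_mul_polyRed hG1 hNp
  have e2 := map_eq_C_mul_polyRed hG2 hNp
  have e3 := map_eq_C_mul_polyRed hG3 hNp
  have hdeg : ∀ i, ((v i).map (Int.castRingHom (ZMod p))).natDegree ≤ (v i).natDegree :=
    fun i => natDegree_map_le
  refine ⟨(v 0).map (Int.castRingHom (ZMod p)), (v 1).map (Int.castRingHom (ZMod p)),
    (v 2).map (Int.castRingHom (ZMod p)), (hdeg 0).trans (by omega), (hdeg 1).trans (by omega),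
    (hdeg 2).trans (by omega), ?_, ?_⟩
  · convert hind p (hcast M hM (by omega)) using 1
    ext1 i
    fin_cases i <;> rfl
  · intro a b
    refine Finset.sum_congr rfl fun y _ => ?_
    have h0 : (v 0).map (Int.castRingHom (ZMod p)) =
        C (N : ZMod p) * polyRed p P.num * (C (N : ZMod p) * polyRed p Q.denom) := by
      rw [← e0, ← e3, ← Polynomial.map_mul]; rfl
    have h1 : (v 1).map (Int.castRingHom (ZMod p)) =
        C (N : ZMod p) * polyRed p Q.num * (C (N : ZMod p) * polyRed p P.denom) := by
      rw [← e2, ← e1, ← Polynomial.map_mul]; rfl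
    have h2 : (v 2).map (Int.castRingHom (ZMod p)) =
        C (N : ZMod p) * polyRed p P.denom * (C (N : ZMod p) * polyRed p Q.denom) := by
      rw [← e1, ← e3, ← Polynomial.map_mul]; rfl
    rw [fracChar, h0, h1, h2]
    simp only [eval_mul, eval_add, eval_C, mul_eq_zero, hNp, false_or, IsPole, evalRed,
      ← not_or, ite_not, ep_eq_stdAddChar]
    split_ifs with hy
    · rfl
    · rw [not_or] at hy
      obtain ⟨hy1, hy2⟩ := hy
      congr 1
      field_simp

/-- Square root cancellation, uniform in the prime, in the exponential sums of linear combinations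
of `P` and `Q`. -/
theorem exists_norm_nonpoleSum_sub_le (P Q : RatFunc ℚ)
    (hPQ : LinearIndependent ℚ ![P, Q, (1 : RatFunc ℚ)]) :
    ∃ A : ℝ, 0 < A ∧ ∀ (p : ℕ) [Fact p.Prime] (a b : ZMod p),
      ‖nonpoleSum p P Q a b - if a = 0 ∧ b = 0 then (p : ℂ) else 0‖ ≤ A * √p := by
  obtain ⟨D, p₀, h⟩ := exists_nonpoleSum_eq P Q hPQ
  refine ⟨4 * D + 2 + 2 * √(p₀ + D : ℕ), by positivity, fun p _ a b => ?_⟩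
  have hp : p.Prime := Fact.out
  have hp1 : 1 ≤ √(p : ℝ) := Real.one_le_sqrt.2 (by exact_mod_cast hp.one_le)
  have hD : (0 : ℝ) ≤ D := Nat.cast_nonneg _
  have hs0 := Real.sqrt_nonneg ((p₀ + D : ℕ) : ℝ)
  rcases le_or_gt p (p₀ + D) with hsmall | hlarge
  · have h1 : ‖(if a = 0 ∧ b = 0 then (p : ℂ) else 0)‖ ≤ p := by
      split_ifs <;> simp
    have h2 := (norm_sub_le (nonpoleSum p P Q a b) (if a = 0 ∧ b = 0 then (p : ℂ) else 0)).trans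
      (add_le_add (norm_nonpoleSum_le P Q a b) h1)
    have h3 : √(p : ℝ) ≤ √((p₀ + D : ℕ) : ℝ) := Real.sqrt_le_sqrt (by exact_mod_cast hsmall)
    have h4 : √(p : ℝ) * √(p : ℝ) = p := Real.mul_self_sqrt (Nat.cast_nonneg _)
    nlinarith
  · obtain ⟨g₁, g₂, k, hg₁, hg₂, hk, hind, heq⟩ := h p (by omega)
    rw [Fintype.linearIndependent_iff] at hind
    have hk0 : k ≠ 0 := by
      rintro rfl
      have := hind ![0, 0, 1] (by simp [Fin.sum_univ_three]) 2
      simp at this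
    rw [heq]
    by_cases hab : a = 0 ∧ b = 0
    · rw [if_pos hab, hab.1, hab.2]
      have h1 : ∑ y, fracChar (ZMod.stdAddChar) (C 0 * g₁ + C 0 * g₂) k y - (p : ℂ) =
          -((Finset.univ.filter fun y : ZMod p => k.eval y = 0).card : ℂ) := by
        have h2 := Finset.card_filter_add_card_filter_not (s := (Finset.univ : Finset (ZMod p)))
          (fun y => k.eval y = 0)
        rw [Finset.card_univ, ZMod.card] at h2
        have h3 : ∑ y, fracChar (ZMod.stdAddChar) (C 0 * g₁ + C 0 * g₂) k y =
            ((Finset.univ.filter fun y : ZMod p => ¬ k.eval y = 0).card : ℂ) := by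
          rw [Finset.card_eq_sum_ones, Finset.sum_filter, Nat.cast_sum]
          refine Finset.sum_congr rfl fun y _ => ?_
          by_cases hy : k.eval y = 0 <;> simp [fracChar, hy]
        have h4 : ((Finset.univ.filter fun y : ZMod p => k.eval y = 0).card : ℂ) +
            ((Finset.univ.filter fun y : ZMod p => ¬ k.eval y = 0).card : ℂ) = p := by
          exact_mod_cast h2
        rw [h3]
        linear_combination h4
      rw [h1, norm_neg, Complex.norm_natCast]
      have h2 : ((Finset.univ.filter fun y : ZMod p => k.eval y = 0).card : ℝ) ≤ D := by
        exact_mod_cast (card_rootSet_filter_le hk0).trans hk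
      nlinarith
    · rw [if_neg hab, sub_zero]
      have h1 := norm_sum_fracChar_le (g := C a * g₁ + C b * g₂) (D := D) hk0
        (natDegree_add_le_of_degree_le ((natDegree_C_mul_le _ _).trans hg₁)
          ((natDegree_C_mul_le _ _).trans hg₂)) hk (by omega) (fun c hc => hab ?_)
        (stdAddChar_ne_one (p := p))
      · nlinarith
      · have h2 := hind ![a, b, -c] (by
          simp [Fin.sum_univ_three, smul_eq_C_mul, hc])
        exact ⟨h2 0, h2 1⟩

variable {p : ℕ} [Fact p.Prime] {f f1 f2 : ZMod p × ZMod p → ℂ}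

theorem sum_ep_mul (c : ZMod p) : ∑ a : ZMod p, ep p (c * a) = if c = 0 then (p : ℂ) else 0 := by
  have h := AddChar.sum_mulShift c (ZMod.isPrimitive_stdAddChar p)
  rw [ZMod.card, Nat.cast_ite, Nat.cast_zero] at h
  rw [← h]
  exact Finset.sum_congr rfl fun a _ => by rw [ep_eq_stdAddChar, mul_comm]

theorem IsEigen1.exists_frequency (hf : IsEigen1 p f) : ∃ φ : ZMod p → ZMod p,
    (∀ x1 x2 t, f (x1 + t, x2) = f (x1, x2) * ep p (φ x2 * t)) ∧
    ∀ x1 x2, ∑ a, f (a, x2) = f (x1, x2) * if φ x2 = 0 then (p : ℂ) else 0 := by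
  obtain ⟨E, φ, ψ, h⟩ := hf
  have hshift : ∀ x1 x2 t, f (x1 + t, x2) = f (x1, x2) * ep p (φ x2 * t) := by
    intro x1 x2 t
    rw [h, h, mul_add, ep_eq_stdAddChar, ep_eq_stdAddChar, ep_eq_stdAddChar,
      AddChar.map_add_eq_mul]
    ring
  refine ⟨φ, hshift, fun x1 x2 => ?_⟩
  rw [← sum_ep_mul, Finset.mul_sum, ← Equiv.sum_comp (Equiv.addLeft x1)]
  exact Finset.sum_congr rfl fun a _ => hshift x1 x2 a

theorem IsEigen2.exists_frequency (hf : IsEigen2 p f) : ∃ φ : ZMod p → ZMod p,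
    (∀ x1 x2 t, f (x1, x2 + t) = f (x1, x2) * ep p (φ x1 * t)) ∧
    ∀ x1 x2, ∑ b, f (x1, b) = f (x1, x2) * if φ x1 = 0 then (p : ℂ) else 0 := by
  obtain ⟨E, φ, ψ, h⟩ := hf
  obtain ⟨φ', h1, h2⟩ := IsEigen1.exists_frequency (f := fun x => f (x.2, x.1))
    ⟨E, φ, ψ, fun x1 x2 => h x2 x1⟩
  exact ⟨φ', fun x1 x2 t => h1 x2 x1 t, fun x1 x2 => h2 x2 x1⟩

theorem cornerAvg_eq (P Q : RatFunc ℚ) (f0 : ZMod p × ZMod p → ℂ) {φ₁ φ₂ : ZMod p → ZMod p}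
    (h1 : ∀ x1 x2 t, f1 (x1 + t, x2) = f1 (x1, x2) * ep p (φ₁ x2 * t))
    (h2 : ∀ x1 x2 t, f2 (x1, x2 + t) = f2 (x1, x2) * ep p (φ₂ x1 * t)) :
    cornerAvg p P Q f0 f1 f2 = (p : ℂ)⁻¹ ^ 3 * ∑ x1 : ZMod p, ∑ x2 : ZMod p,
      f0 (x1, x2) * f1 (x1, x2) * f2 (x1, x2) * nonpoleSum p P Q (φ₁ x2) (φ₂ x1) := by
  unfold cornerAvg nonpoleSum
  congr 1
  refine Finset.sum_congr rfl fun x1 _ => Finset.sum_congr rfl fun x2 _ => ?_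
  rw [Finset.mul_sum]
  refine Finset.sum_congr rfl fun y _ => ?_
  split_ifs
  · rw [h1, h2, ep_eq_stdAddChar, ep_eq_stdAddChar, ep_eq_stdAddChar, AddChar.map_add_eq_mul]
    ring
  · rw [mul_zero]

theorem mainTerm_eq (f0 : ZMod p × ZMod p → ℂ) {φ₁ φ₂ : ZMod p → ZMod p}
    (h1 : ∀ x1 x2, ∑ a, f1 (a, x2) = f1 (x1, x2) * if φ₁ x2 = 0 then (p : ℂ) else 0)
    (h2 : ∀ x1 x2, ∑ b, f2 (x1, b) = f2 (x1, x2) * if φ₂ x1 = 0 then (p : ℂ) else 0) :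
    mainTerm p f0 f1 f2 = (p : ℂ)⁻¹ ^ 3 * ∑ x1 : ZMod p, ∑ x2 : ZMod p,
      f0 (x1, x2) * f1 (x1, x2) * f2 (x1, x2) *
        if φ₁ x2 = 0 ∧ φ₂ x1 = 0 then (p : ℂ) else 0 := by
  have hp : (p : ℂ) ≠ 0 := by exact_mod_cast (Fact.out : p.Prime).ne_zero
  unfold mainTerm
  rw [pow_succ _ 2, mul_assoc]
  simp_rw [Finset.mul_sum Finset.univ _ (p : ℂ)⁻¹]
  congr 1
  refine Finset.sum_congr rfl fun x1 _ => Finset.sum_congr rfl fun x2 _ => ?_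
  rw [← Finset.mul_sum, ← Finset.mul_sum, h1 x1, h2 x1 x2]
  by_cases ha : φ₁ x2 = 0 <;> by_cases hb : φ₂ x1 = 0 <;> simp [ha, hb]
  field_simp

end CornerSums

/-- **Theorem 5.4.(1).** Base case of degree lowering: asymptotic formula for the corner
counting operator when `f₁` is an eigenfunction with respect to the first coordinate and
`f₂` is an eigenfunction with respect to the second coordinate. -/
theorem degree_lowering_base (P Q : RatFunc ℚ)
    (hPQ : LinearIndependent ℚ ![P, Q, (1 : RatFunc ℚ)]) :
    ∃ C : ℝ, 0 < C ∧ ∀ (p : ℕ) [Fact p.Prime],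
      Admissible p P → Admissible p Q →
      ∀ f0 f1 f2 : ZMod p × ZMod p → ℂ,
        OneBounded f0 → OneBounded f1 → OneBounded f2 →
        IsEigen1 p f1 → IsEigen2 p f2 →
        ‖cornerAvg p P Q f0 f1 f2 - mainTerm p f0 f1 f2‖ ≤
          C * (p : ℝ) ^ (-(1 : ℝ) / 2) := by
  obtain ⟨A, hA, h⟩ := exists_norm_nonpoleSum_sub_le P Q hPQ
  refine ⟨A, hA, fun p _ _ _ f0 f1 f2 hf0 hf1 hf2 he1 he2 => ?_⟩
  obtain ⟨φ₁, hs1, ha1⟩ := he1.exists_frequency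
  obtain ⟨φ₂, hs2, ha2⟩ := he2.exists_frequency
  have hp : (0 : ℝ) < p := by exact_mod_cast (Fact.out : p.Prime).pos
  have hpow : (p : ℝ) ^ (-(1 : ℝ) / 2) = (√(p : ℝ))⁻¹ := by
    rw [neg_div, Real.rpow_neg hp.le, Real.sqrt_eq_rpow]
  rw [cornerAvg_eq P Q f0 hs1 hs2, mainTerm_eq f0 ha1 ha2, ← mul_sub, ← Finset.sum_sub_distrib,
    norm_mul, norm_pow, norm_inv, Complex.norm_natCast, hpow]
  have hsum : ∀ x1 : ZMod p, ‖(∑ x2 : ZMod p, f0 (x1, x2) * f1 (x1, x2) * f2 (x1, x2) *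
        nonpoleSum p P Q (φ₁ x2) (φ₂ x1)) - ∑ x2 : ZMod p,
        f0 (x1, x2) * f1 (x1, x2) * f2 (x1, x2) *
          if φ₁ x2 = 0 ∧ φ₂ x1 = 0 then (p : ℂ) else 0‖ ≤ p * (A * √p) := by
    intro x1
    rw [← Finset.sum_sub_distrib]
    refine (norm_sum_le_of_le _ (n := fun _ => A * √p) fun x2 _ => ?_).trans_eq (by simp)
    rw [← mul_sub, norm_mul, norm_mul, norm_mul]
    have h1 : ‖f0 (x1, x2)‖ * ‖f1 (x1, x2)‖ * ‖f2 (x1, x2)‖ ≤ 1 :=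
      mul_le_one₀ (mul_le_one₀ (hf0 _) (norm_nonneg _) (hf1 _)) (norm_nonneg _) (hf2 _)
    exact (mul_le_of_le_one_left (norm_nonneg _) h1).trans (h p _ _)
  calc ((p : ℝ)⁻¹) ^ 3 * _ ≤ ((p : ℝ)⁻¹) ^ 3 * (p * (p * (A * √p))) := by
        gcongr
        exact (norm_sum_le_of_le _ fun x1 _ => hsum x1).trans_eq (by simp)
    _ = A * (√(p : ℝ))⁻¹ := by
        have hs : √(p : ℝ) ≠ 0 := (Real.sqrt_pos.2 hp).ne'
        have hss : √(p : ℝ) * √(p : ℝ) = p := Real.mul_self_sqrt hp.le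
        field_simp
        rw [sq, hss]
end RatCorners
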